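/- arXiv:2006.01041 — 4 statements merged into one kernel-verified Lean document; each statement's English description precedes it below -/
import Mathlib

section
/- Let A = {0 = a_0 < a_1 < ... < a_{ℓ+1} = b} be a finite set of integers with gcd(a_1, ..., a_{ℓ+1}) = 1 and ℓ ≥ 1. Then for every integer N ≥ b − ℓ, the N-fold sumset NA equals {0, 1, ..., bN} \ (E(A) ∪ (bN − E(b−A))). -/
open Pointwise

/-- The `N`-fold sumset of a finite set `A` (sums of `N` not-necessarily-distinct elements),
with the `0`-fold sumset being `{0}`. -/
def nfold {α : Type*} [AddMonoid α] [DecidableEq α] (A : Finset α) : ℕ → Finset α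
  | 0 => {0}
  | n + 1 => nfold A n + A

/-- `postP A` is the set of integers expressible as a finite (nonempty) sum of elements of `A`. -/
def postP (A : Finset ℤ) : Set ℤ := {n | ∃ N : ℕ, 1 ≤ N ∧ n ∈ nfold A N}

/-- The exceptional set `E(A)`. -/
def postE (A : Finset ℤ) : Set ℤ := {n | 1 ≤ n ∧ n ∉ postP A}

/-- `n_{a,A}`: the least `n ≥ 1` with `n ∈ P(A)` and `n ≡ a (mod b)`. -/
noncomputable def nmin (A : Finset ℤ) (b a : ℤ) : ℤ :=
  sInf {n : ℤ | 1 ≤ n ∧ n ∈ postP A ∧ n % b = a % b}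

/-- `N_{a,A}`: the least `N ≥ 1` with `n_{a,A} ∈ NA`. -/
noncomputable def Nmin (A : Finset ℤ) (b a : ℤ) : ℕ :=
  sInf {N : ℕ | 1 ≤ N ∧ nmin A b a ∈ nfold A N}

/-- `N_A^* = max_{1 ≤ a ≤ b-1} N_{a,A}`. -/
noncomputable def Nstar (A : Finset ℤ) (b : ℤ) : ℕ :=
  (Finset.Icc 1 (b - 1)).sup (fun a => Nmin A b a)

section Nfold

variable {A : Finset ℤ} {b : ℤ}

lemma add_mem_nfold {m n : ℤ} {M N : ℕ} (hm : m ∈ nfold A M) (hn : n ∈ nfold A N) :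
    m + n ∈ nfold A (M + N) := by
  induction N generalizing n with
  | zero =>
    obtain rfl : n = 0 := by simpa [nfold] using hn
    simpa using hm
  | succ N ih =>
    obtain ⟨k, hk, a, ha, rfl⟩ := Finset.mem_add.1 hn
    rw [← add_assoc m]
    exact Finset.add_mem_add (ih hk) ha

lemma mem_nfold_one {a : ℤ} (ha : a ∈ A) : a ∈ nfold A 1 := by
  rw [nfold, nfold, Finset.mem_add]
  exact ⟨0, by simp, a, ha, zero_add a⟩

lemma sum_mem_nfold {x : List ℤ} (hx : ∀ a ∈ x, a ∈ A) : x.sum ∈ nfold A x.length := by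
  induction x with
  | nil => simp [nfold]
  | cons a x ih =>
    rw [List.sum_cons, List.length_cons, add_comm a]
    exact Finset.add_mem_add (ih fun c hc => hx c (List.mem_cons_of_mem _ hc))
      (hx a List.mem_cons_self)

lemma exists_sorted_list_of_mem_nfold {n : ℤ} {N : ℕ} (hn : n ∈ nfold A N) :
    ∃ x : List ℤ, x.Pairwise (· ≤ ·) ∧ x.length = N ∧ (∀ a ∈ x, a ∈ A) ∧ x.sum = n := by
  have h : ∃ s : Multiset ℤ, s.card = N ∧ (∀ a ∈ s, a ∈ A) ∧ s.sum = n := by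
    induction N generalizing n with
    | zero => exact ⟨0, by simp, by simp, by simpa [nfold, eq_comm] using hn⟩
    | succ N ih =>
      obtain ⟨k, hk, a, ha, rfl⟩ := Finset.mem_add.1 hn
      obtain ⟨s, hs, hsA, rfl⟩ := ih hk
      refine ⟨a ::ₘ s, by simp [hs], ?_, by simp [add_comm]⟩
      intro c hc
      rcases Multiset.mem_cons.1 hc with rfl | hc
      exacts [ha, hsA c hc]
  obtain ⟨s, hs, hsA, hsum⟩ := h
  refine ⟨s.sort (· ≤ ·), s.pairwise_sort _, by simpa using hs, by simpa using hsA, ?_⟩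
  rw [← Multiset.sum_coe, Multiset.sort_eq, hsum]

lemma zero_mem_nfold (h0 : 0 ∈ A) (N : ℕ) : 0 ∈ nfold A N := by
  simpa using sum_mem_nfold (x := List.replicate N 0) (A := A)
    (fun a ha => (List.eq_of_mem_replicate ha) ▸ h0)

lemma mul_mem_nfold (hb : b ∈ A) (k : ℕ) : (k : ℤ) * b ∈ nfold A k := by
  simpa using sum_mem_nfold (x := List.replicate k b) (A := A)
    (fun a ha => (List.eq_of_mem_replicate ha) ▸ hb)

lemma add_mul_mem_nfold (h0 : 0 ∈ A) (hb : b ∈ A) {m k : ℤ} {M N : ℕ} (hm : m ∈ nfold A M)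
    (hk : 0 ≤ k) (hN : M + k ≤ N) : m + k * b ∈ nfold A N := by
  lift k to ℕ using hk
  obtain ⟨r, rfl⟩ : ∃ r, N = M + k + r := ⟨N - (M + k), by omega⟩
  simpa using add_mem_nfold (add_mem_nfold hm (mul_mem_nfold hb k)) (zero_mem_nfold h0 r)

lemma nonneg_of_mem_nfold (hmin : ∀ a ∈ A, 0 ≤ a) {n : ℤ} {N : ℕ} (hn : n ∈ nfold A N) :
    0 ≤ n := by
  induction N generalizing n with
  | zero => simp_all [nfold]
  | succ N ih =>
    obtain ⟨k, hk, a, ha, rfl⟩ := Finset.mem_add.1 hn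
    exact add_nonneg (ih hk) (hmin a ha)

lemma le_of_mem_nfold (hmax : ∀ a ∈ A, a ≤ b) {n : ℤ} {N : ℕ} (hn : n ∈ nfold A N) :
    n ≤ b * N := by
  induction N generalizing n with
  | zero => simp_all [nfold]
  | succ N ih =>
    obtain ⟨k, hk, a, ha, rfl⟩ := Finset.mem_add.1 hn
    push_cast
    linarith [ih hk, hmax a ha]

lemma mem_nfold_reflect (b : ℤ) {n : ℤ} {N : ℕ} (hn : n ∈ nfold A N) :
    b * N - n ∈ nfold (A.image (fun x => b - x)) N := by
  induction N generalizing n with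
  | zero => simp_all [nfold]
  | succ N ih =>
    obtain ⟨k, hk, a, ha, rfl⟩ := Finset.mem_add.1 hn
    have : b * (N + 1 : ℕ) - (k + a) = (b * N - k) + (b - a) := by push_cast; ring
    rw [this]
    exact Finset.add_mem_add (ih hk) (Finset.mem_image_of_mem _ ha)

lemma mem_nfold_reflect_iff (b : ℤ) {n : ℤ} {N : ℕ} :
    b * N - n ∈ nfold (A.image (fun x => b - x)) N ↔ n ∈ nfold A N := by
  refine ⟨fun h => ?_, mem_nfold_reflect b⟩
  have := mem_nfold_reflect b h
  simpa [Finset.image_image, Function.comp_def] using this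

end Nfold

lemma sum_take_mul_length_le {x : List ℤ} (hx : x.Pairwise (· ≤ ·)) {i : ℕ}
    (hi : i ≤ x.length) : (x.take i).sum * x.length ≤ i * x.sum := by
  rcases hi.eq_or_lt with rfl | hi
  · rw [List.take_length, mul_comm]
  · have hsplit := List.take_append_drop i x
    have hp := hx
    rw [← hsplit, List.pairwise_append] at hp
    obtain ⟨-, hp, hcross⟩ := hp
    have h1 : (x.take i).sum ≤ i * x[i] := by
      have := List.sum_le_card_nsmul (x.take i) x[i] fun a ha =>
        hcross a ha _ (by rw [List.drop_eq_getElem_cons hi]; exact List.mem_cons_self)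
      simpa [min_eq_left hi.le] using this
    have h2 : ((x.length : ℤ) - i) * x[i] ≤ (x.drop i).sum := by
      have := List.card_nsmul_le_sum (x.drop i) x[i] fun a ha => by
        rw [List.drop_eq_getElem_cons hi] at ha hp
        rcases List.mem_cons.1 ha with rfl | ha
        exacts [le_rfl, List.rel_of_pairwise_cons hp ha]
      simpa [Nat.cast_sub hi.le] using this
    have h3 : x.sum = (x.take i).sum + (x.drop i).sum := by
      rw [← List.sum_append, hsplit]
    have hi' : (0 : ℤ) ≤ (x.length : ℤ) - i := by omega
    rw [h3]
    nlinarith [mul_le_mul_of_nonneg_left h1 hi',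
      mul_le_mul_of_nonneg_left h2 (Int.natCast_nonneg i)]

/-- `x` lists the summands of a point `(x.sum, x.length)` of the semigroup generated by the
`(a, 1)` with `a ∈ A`, which is reached from the missing point `(n, N)` by adding `(0, 1)` and
subtracting `(b, 1)` as often as possible, namely `d` times. The list is increasing. -/
structure IsHoleCorner (A : Finset ℤ) (b n : ℤ) (N d : ℕ) (x : List ℤ) : Prop where
  not_mem : n ∉ nfold A N
  sorted : x.Pairwise (· ≤ ·)
  mem : ∀ a ∈ x, a ∈ A
  length_add : x.length + d = N + 1
  sum_eq : x.sum = n - d * b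
  sum_sub_not_mem : ∀ M : ℕ, M + 1 = x.length → x.sum - b ∉ nfold A M

namespace IsHoleCorner

variable {A : Finset ℤ} {b n : ℤ} {N d : ℕ} {x : List ℤ}

lemma exists_of_mem (hn : n ∉ nfold A N) (hn' : n ∈ nfold A (N + 1)) :
    ∃ d x, IsHoleCorner A b n N d x := by
  classical
  let P : ℕ → Prop := fun d => d ≤ N + 1 ∧ n - d * b ∈ nfold A (N + 1 - d)
  have h0 : P 0 := ⟨by omega, by simpa using hn'⟩
  obtain ⟨hd, hmem⟩ : P (Nat.findGreatest P (N + 1)) := Nat.findGreatest_spec (by omega) h0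
  set d := Nat.findGreatest P (N + 1)
  obtain ⟨x, hsort, hlen, hxA, hsum⟩ := exists_sorted_list_of_mem_nfold hmem
  refine ⟨d, x, hn, hsort, hxA, by omega, hsum, fun M hM hcon => ?_⟩
  have hP : P (d + 1) := by
    refine ⟨by omega, ?_⟩
    have h1 : N + 1 - (d + 1) = M := by omega
    have h2 : n - ((d + 1 : ℕ) : ℤ) * b = x.sum - b := by rw [hsum]; push_cast; ring
    rw [h1, h2]
    exact hcon
  have := Nat.le_findGreatest (P := P) (by omega : d + 1 ≤ N + 1) hP
  omega

lemma sum_take_mem (h : IsHoleCorner A b n N d x) {i : ℕ} (hi : i ≤ x.length) :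
    (x.take i).sum ∈ nfold A i := by
  have := sum_mem_nfold (A := A) (x := x.take i) fun a ha => h.mem a (List.mem_of_mem_take ha)
  rwa [List.length_take, min_eq_left hi] at this

lemma cliff (h : IsHoleCorner A b n N d x) (h0 : 0 ∈ A) (hb : b ∈ A) {i M : ℕ} {s w : ℤ}
    (hi : i ≤ x.length) (hs : s ∈ nfold A M) (hw : s = (x.take i).sum + w * b) (hwd : w ≤ d)
    (hM : (M : ℤ) < i + w ∨ (M : ℤ) = i + w ∧ w < 0) : False := by
  have hrest := sum_mem_nfold (A := A) (x := x.drop i)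
    fun a ha => h.mem a (List.mem_of_mem_drop ha)
  rw [List.length_drop] at hrest
  have hsum : x.sum = (x.take i).sum + (x.drop i).sum := by
    rw [← List.sum_append, List.take_append_drop]
  have hadd := add_mem_nfold hs hrest
  have hlen := h.length_add
  rcases hM with hM | ⟨hM, hw0⟩
  · refine h.not_mem ?_
    have := add_mul_mem_nfold (N := N) (k := d - w) h0 hb hadd (by omega) (by omega)
    convert this using 1
    linear_combination (-1 : ℤ) * h.sum_eq + hsum - hw
  · obtain ⟨K, hK⟩ : ∃ K, K + 1 = x.length := ⟨x.length - 1, by omega⟩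
    refine h.sum_sub_not_mem K hK ?_
    have := add_mul_mem_nfold (N := K) (k := -1 - w) h0 hb hadd (by omega) (by omega)
    convert this using 1
    linear_combination hsum - hw

lemma not_dvd_sum_take_sub_sum_take (h : IsHoleCorner A b n N d x) (hb0 : 0 < b) (h0 : 0 ∈ A)
    (hb : b ∈ A) (hmin : ∀ a ∈ A, 0 ≤ a) (hmax : ∀ a ∈ A, a ≤ b) {i k : ℕ} (hik : i < k)
    (hk : k ≤ x.length) : ¬ b ∣ (x.take k).sum - (x.take i).sum := by
  rintro ⟨v, hv⟩
  obtain ⟨r, rfl⟩ : ∃ r, k = i + r := ⟨k - i, by omega⟩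
  have hseg := sum_mem_nfold (A := A) (x := (x.drop i).take r)
    fun a ha => h.mem a (List.mem_of_mem_drop (List.mem_of_mem_take ha))
  have hsum : (x.take (i + r)).sum = (x.take i).sum + ((x.drop i).take r).sum := by
    rw [← List.sum_append, List.take_add]
  have hlen : ((x.drop i).take r).length = r := by simp; omega
  rw [hlen] at hseg
  have hseg' : ((x.drop i).take r).sum = b * v := by linarith
  rw [hseg'] at hseg
  have hv0 : 0 ≤ v := nonneg_of_mul_nonneg_right (nonneg_of_mem_nfold hmin hseg) hb0
  have hvr : v ≤ r := le_of_mul_le_mul_left (le_of_mem_nfold hmax hseg) hb0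
  refine h.cliff h0 hb hk (h.sum_take_mem (by omega : i ≤ x.length)) (w := -v)
    (by linarith) (by omega) ?_
  push_cast
  omega

lemma not_dvd_sum_take_sub (h : IsHoleCorner A b n N d x) (hb0 : 0 < b) (h0 : 0 ∈ A)
    (hb : b ∈ A) (hmin : ∀ a ∈ A, 0 ≤ a) (hmax : ∀ a ∈ A, a ≤ b) {i : ℕ} (hi : 2 ≤ i)
    (hix : i ≤ x.length) {a : ℤ} (ha : a ∈ A) : ¬ b ∣ (x.take i).sum - a := by
  intro hdvd
  have hzero := h.not_dvd_sum_take_sub_sum_take hb0 h0 hb hmin hmax (by omega : 0 < i) hix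
  simp only [List.take_zero, List.sum_nil, sub_zero] at hzero
  rcases (hmin a ha).eq_or_lt with rfl | ha0
  · simp_all
  rcases (hmax a ha).eq_or_lt with rfl | hab
  · exact hzero (by simpa using hdvd)
  obtain ⟨v, hv⟩ := hdvd
  have hmem := h.sum_take_mem hix
  have h1 := nonneg_of_mem_nfold hmin hmem
  have h2 := le_of_mem_nfold hmax hmem
  have hv0 : -1 < v := by
    refine lt_of_mul_lt_mul_left (a := b) ?_ hb0.le
    linarith
  have hvi : v < i := by
    refine lt_of_mul_lt_mul_left (a := b) ?_ hb0.le
    linarith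
  refine h.cliff h0 hb hix (mem_nfold_one ha) (w := -v) (by linarith) (by omega) ?_
  push_cast
  omega

end IsHoleCorner

/-- Two prefixes of sorted lists, one of smaller mean than the other, are not comparable. -/
lemma false_of_mean_lt {b X Y X' Y' K L i k : ℤ} (hK : 0 < K) (hL : 0 < L)
    (hk : 0 < k) (hX : 0 ≤ X) (hXb : X ≤ b * K)
    (hx : X' * K ≤ i * X) (hy : k * Y ≤ Y' * L) (hlt : X * L < Y * K)
    (h1 : Y' ≤ X') (h2 : b * i - X' ≤ b * k - Y') : False := by
  have hKL := mul_pos hK hL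
  have hki : k < i := by
    have e1 : k * (Y * K) ≤ i * (X * L) := by
      nlinarith [mul_le_mul_of_nonneg_right hy hK.le, mul_le_mul_of_nonneg_right hx hL.le,
        mul_le_mul_of_nonneg_right h1 hKL.le]
    have e2 : k * (X * L) < i * (X * L) := by nlinarith [mul_lt_mul_of_pos_left hlt hk]
    exact lt_of_mul_lt_mul_right e2 (mul_nonneg hX hL.le)
  have hik : i < k := by
    have e1 : i * ((b * K - X) * L) ≤ k * ((b * L - Y) * K) := by
      nlinarith [mul_le_mul_of_nonneg_right hy hK.le, mul_le_mul_of_nonneg_right hx hL.le,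
        mul_le_mul_of_nonneg_right h2 hKL.le]
    have e2 : i * ((b * K - X) * L) < k * ((b * K - X) * L) := by
      nlinarith [mul_lt_mul_of_pos_left hlt hk]
    exact lt_of_mul_lt_mul_right e2 (mul_nonneg (by linarith) hL.le)
  omega

lemma exists_hole {A : Finset ℤ} {b n : ℤ} {N M M' : ℕ} (h0 : 0 ∈ A) (hb : b ∈ A)
    (hn : n ∉ nfold A N) (hM : n ∈ nfold A M)
    (hM' : b * N - n ∈ nfold (A.image (fun x => b - x)) M') :
    ∃ n' N', N ≤ N' ∧ n' ∉ nfold A N' ∧ n' ∈ nfold A (N' + 1) ∧ n' + b ∈ nfold A (N' + 1) := by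
  classical
  have hpad : ∀ {m : ℤ} {P Q : ℕ}, m ∈ nfold A P → P ≤ Q → m ∈ nfold A Q := by
    intro m P Q hm hPQ
    simpa using add_mul_mem_nfold (k := 0) (N := Q) h0 hb hm le_rfl (by omega)
  obtain ⟨s, hs1, hs2⟩ : ∃ s, n ∉ nfold A (N + s) ∧ n ∈ nfold A (N + s + 1) := by
    by_contra hcon
    push Not at hcon
    have hnone : ∀ s, n ∉ nfold A (N + s) := fun s => by
      induction s with
      | zero => exact hn
      | succ s ih => exact hcon s ih
    exact hnone M (hpad hM (by omega))
  have hend : n + (M' : ℕ) * b ∈ nfold A (N + s + M') := by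
    rw [← mem_nfold_reflect_iff b]
    have h0' : 0 ∈ A.image (fun x => b - x) := Finset.mem_image.2 ⟨b, hb, sub_self b⟩
    have hb' : b ∈ A.image (fun x => b - x) := Finset.mem_image.2 ⟨0, h0, sub_zero b⟩
    have := add_mul_mem_nfold (k := s) (N := N + s + M') h0' hb' hM' (by omega)
      (by push_cast; omega)
    convert this using 1
    push_cast
    ring
  obtain ⟨t, ht1, ht2⟩ : ∃ t : ℕ, n + t * b ∉ nfold A (N + s + t) ∧
      n + (t + 1 : ℕ) * b ∈ nfold A (N + s + (t + 1)) := by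
    by_contra hcon
    push Not at hcon
    have hnone : ∀ t : ℕ, n + t * b ∉ nfold A (N + s + t) := fun t => by
      induction t with
      | zero => simpa using hs1
      | succ t ih => exact hcon t ih
    exact hnone M' hend
  refine ⟨n + t * b, N + s + t, by omega, ht1, ?_, ?_⟩
  · exact add_mul_mem_nfold h0 hb hs2 (by omega) (by push_cast; omega)
  · have e : n + t * b + b = n + (t + 1 : ℕ) * b := by push_cast; ring
    rw [e]
    exact ht2

lemma hole_degree_lt {A : Finset ℤ} {b n : ℤ} {N : ℕ} (hb0 : 0 < b) (h0 : 0 ∈ A) (hb : b ∈ A)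
    (hmin : ∀ a ∈ A, 0 ≤ a) (hmax : ∀ a ∈ A, a ≤ b) (h1 : n ∉ nfold A N)
    (h2 : n ∈ nfold A (N + 1)) (h3 : n + b ∈ nfold A (N + 1)) :
    (N : ℤ) + A.card ≤ b + 1 := by
  set A' := A.image (fun x => b - x)
  have h0' : 0 ∈ A' := Finset.mem_image.2 ⟨b, hb, sub_self b⟩
  have hb' : b ∈ A' := Finset.mem_image.2 ⟨0, h0, sub_zero b⟩
  have hmin' : ∀ a ∈ A', 0 ≤ a := by
    intro a ha
    obtain ⟨c, hc, rfl⟩ := Finset.mem_image.1 ha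
    linarith [hmax c hc]
  have hmax' : ∀ a ∈ A', a ≤ b := by
    intro a ha
    obtain ⟨c, hc, rfl⟩ := Finset.mem_image.1 ha
    linarith [hmin c hc]
  obtain ⟨d, x, hx⟩ := IsHoleCorner.exists_of_mem (b := b) h1 h2
  obtain ⟨d', y, hy⟩ : ∃ d' y, IsHoleCorner A' b (b * N - n) N d' y := by
    refine IsHoleCorner.exists_of_mem (mt (mem_nfold_reflect_iff b).1 h1) ?_
    have := mem_nfold_reflect b h3
    convert this using 1
    push_cast
    ring
  have hxl := hx.length_add
  have hyl := hy.length_add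
  have hX := hx.sum_eq
  have hY := hy.sum_eq
  have hXmem := sum_mem_nfold hx.mem
  have hYmem := sum_mem_nfold hy.mem
  have hX0 := nonneg_of_mem_nfold hmin hXmem
  have hXb := le_of_mem_nfold hmax hXmem
  have hY0 := nonneg_of_mem_nfold hmin' hYmem
  have hn0 : 0 ≤ n := nonneg_of_mem_nfold hmin h2
  have hnN : n ≤ b * N := by
    have := le_of_mem_nfold hmax h3
    push_cast at this
    linarith
  have hxl' : (x.length : ℤ) + d = N + 1 := by exact_mod_cast hxl
  have hyl' : (y.length : ℤ) + d' = N + 1 := by exact_mod_cast hyl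
  have hdy : d + 1 ≤ y.length := by
    have : b * ((d : ℤ) + 1) ≤ b * y.length := by
      have e : (y.length : ℤ) = N + 1 - d' := by linarith
      rw [e]
      linarith
    exact_mod_cast le_of_mul_le_mul_left this hb0
  have hKpos : 0 < x.length := by
    have : b * (d : ℤ) ≤ b * N := by linarith
    have := le_of_mul_le_mul_left this hb0
    omega
  have hXlt : x.sum < b * x.length := by
    refine lt_of_le_of_ne hXb fun heq => ?_
    obtain ⟨K, hK⟩ : ∃ K, K + 1 = x.length := ⟨x.length - 1, by omega⟩
    refine hx.sum_sub_not_mem K hK ?_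
    rw [heq, ← hK]
    convert mul_mem_nfold hb K using 1
    push_cast
    ring
  have hcross : ∀ i, 2 ≤ i → i ≤ x.length → ∀ k, 2 ≤ k → k ≤ d + 1 →
      ¬ b ∣ (x.take i).sum + (y.take k).sum := by
    rintro i hi2 hi k hk2 hk ⟨c, hc⟩
    have hky : k ≤ y.length := hk.trans hdy
    have hxi := hx.sum_take_mem hi
    have hyk := hy.sum_take_mem hky
    have hyk' : b * k - (y.take k).sum ∈ nfold A k := by
      rw [← mem_nfold_reflect_iff b, sub_sub_cancel]
      exact hyk
    have hxi' := mem_nfold_reflect b hxi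
    have hxi0 : 0 < (x.take i).sum := by
      refine lt_of_le_of_ne (nonneg_of_mem_nfold hmin hxi) fun heq => ?_
      exact hx.not_dvd_sum_take_sub hb0 h0 hb hmin hmax hi2 hi h0 (by simp [← heq])
    have hyk0 := nonneg_of_mem_nfold hmin' hyk
    have hv : (k : ℤ) - c ≤ d := by
      have : b * ((k : ℤ) - c) < b * k := by linarith
      have := lt_of_mul_lt_mul_left this hb0.le
      omega
    have hu : (i : ℤ) ≤ c := by
      by_contra hcon
      exact hx.cliff h0 hb hi hyk' (w := k - c) (by linarith) hv (Or.inl (by omega))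
    have hkc : (k : ℤ) ≤ c := by
      by_contra hcon
      exact hy.cliff h0' hb' hky hxi' (w := i - c) (by linarith) (by omega) (Or.inl (by omega))
    have hmx := sum_take_mul_length_le hx.sorted hi
    have hmy := sum_take_mul_length_le hy.sorted hky
    have hbc : b * (k : ℤ) ≤ b * c := mul_le_mul_of_nonneg_left hkc hb0.le
    have hbi : b * (i : ℤ) ≤ b * c := mul_le_mul_of_nonneg_left hu hb0.le
    refine false_of_mean_lt (b := b) (X := x.sum) (Y := b * y.length - y.sum)
      (X' := (x.take i).sum) (Y' := b * k - (y.take k).sum) (K := x.length) (L := y.length)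
      (i := i) (k := k) (by omega) (by omega) (by omega) hX0 hXb hmx ?_ ?_ (by linarith)
      (by linarith)
    · linarith
    · have e1 : b * (y.length : ℤ) - y.sum = x.sum + (d + 1) * b := by
        rw [hX, hY, show (y.length : ℤ) = N + 1 - d' by linarith]
        ring
      have e2 : (y.length : ℤ) = x.length + (d + 1) - (d' + 1) := by linarith
      rw [e1, e2]
      nlinarith [mul_lt_mul_of_pos_right hXlt (by omega : (0 : ℤ) < d + 1),
        mul_nonneg hX0 (by omega : (0 : ℤ) ≤ d' + 1)]
  let F : Finset ℤ := (Finset.Icc 2 x.length).image fun i => (x.take i).sum % b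
  let G : Finset ℤ := (Finset.Icc 2 (d + 1)).image fun k => (-(y.take k).sum) % b
  have hF : F.card = x.length - 1 := by
    rw [Finset.card_image_of_injOn, Nat.card_Icc]
    · omega
    · intro i hi k hk hik
      simp only [Finset.coe_Icc, Set.mem_Icc] at hi hk
      have hmod : (x.take i).sum ≡ (x.take k).sum [ZMOD b] := hik
      rcases lt_trichotomy i k with hlt | heq | hlt
      · exact (hx.not_dvd_sum_take_sub_sum_take hb0 h0 hb hmin hmax hlt hk.2 hmod.dvd).elim
      · exact heq
      · exact (hx.not_dvd_sum_take_sub_sum_take hb0 h0 hb hmin hmax hlt hi.2 hmod.symm.dvd).elim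
  have hG : G.card = d := by
    rw [Finset.card_image_of_injOn, Nat.card_Icc]
    · omega
    · intro i hi k hk hik
      simp only [Finset.coe_Icc, Set.mem_Icc] at hi hk
      have hmod : -(y.take i).sum ≡ -(y.take k).sum [ZMOD b] := hik
      rcases lt_trichotomy i k with hlt | heq | hlt
      · refine (hy.not_dvd_sum_take_sub_sum_take hb0 h0' hb' hmin' hmax' hlt
          (hk.2.trans hdy) ?_).elim
        simpa [neg_add_eq_sub] using hmod.symm.dvd
      · exact heq
      · refine (hy.not_dvd_sum_take_sub_sum_take hb0 h0' hb' hmin' hmax' hlt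
          (hi.2.trans hdy) ?_).elim
        simpa [neg_add_eq_sub] using hmod.dvd
  have hFG : Disjoint F G := by
    rw [Finset.disjoint_left]
    intro r hr hr'
    obtain ⟨i, hi, rfl⟩ := Finset.mem_image.1 hr
    obtain ⟨k, hk, hik⟩ := Finset.mem_image.1 hr'
    rw [Finset.mem_Icc] at hi hk
    have hmod : -(y.take k).sum ≡ (x.take i).sum [ZMOD b] := hik
    exact hcross i hi.1 hi.2 k hk.1 hk.2 (by simpa using hmod.dvd)
  have hE : Disjoint (F ∪ G) (A.erase b) := by
    rw [Finset.disjoint_left]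
    intro r hr hr'
    obtain ⟨hrb, hrA⟩ := Finset.mem_erase.1 hr'
    rcases Finset.mem_union.1 hr with hr | hr
    · obtain ⟨i, hi, rfl⟩ := Finset.mem_image.1 hr
      rw [Finset.mem_Icc] at hi
      exact hx.not_dvd_sum_take_sub hb0 h0 hb hmin hmax hi.1 hi.2 hrA
        (Int.dvd_self_sub_emod)
    · obtain ⟨k, hk, hkr⟩ := Finset.mem_image.1 hr
      rw [Finset.mem_Icc] at hk
      refine hy.not_dvd_sum_take_sub hb0 h0' hb' hmin' hmax' hk.1 (hk.2.trans hdy)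
        (Finset.mem_image_of_mem (fun c => b - c) hrA) ?_
      have e : b ∣ -(y.take k).sum - r := hkr ▸ Int.dvd_self_sub_emod
      have e' : (y.take k).sum - (b - r) = -(-(y.take k).sum - r) - b := by ring
      rw [e']
      exact dvd_sub_self_right.2 ((dvd_neg).2 e)
  have hsub : (F ∪ G) ∪ A.erase b ⊆ Finset.Ico 0 b := by
    intro r hr
    rw [Finset.mem_Ico]
    rcases Finset.mem_union.1 hr with hr | hr
    · rcases Finset.mem_union.1 hr with hr | hr
      all_goals
        obtain ⟨i, -, rfl⟩ := Finset.mem_image.1 hr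
        exact ⟨Int.emod_nonneg _ hb0.ne', Int.emod_lt_of_pos _ hb0⟩
    · obtain ⟨hrb, hrA⟩ := Finset.mem_erase.1 hr
      exact ⟨hmin r hrA, lt_of_le_of_ne (hmax r hrA) hrb⟩
  have hcard := Finset.card_le_card hsub
  rw [Finset.card_union_of_disjoint hE, Finset.card_union_of_disjoint hFG, hF, hG,
    Finset.card_erase_of_mem hb, Int.card_Ico] at hcard
  have hApos := Finset.card_pos.2 ⟨b, hb⟩
  omega

theorem stmt0 (A : Finset ℤ) (b : ℤ) (ℓ : ℕ) (hℓ : 1 ≤ ℓ)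
    (hcard : A.card = ℓ + 2)
    (h0 : 0 ∈ A) (hb : b ∈ A)
    (hmin : ∀ a ∈ A, 0 ≤ a) (hmax : ∀ a ∈ A, a ≤ b)
    (hgcd : A.gcd id = 1)
    (N : ℕ) (hN : b - (ℓ : ℤ) ≤ (N : ℤ)) :
    (↑(nfold A N) : Set ℤ) =
      Set.Icc 0 (b * N) \
        (postE A ∪ (fun m => b * N - m) '' postE (A.image (fun x => b - x))) := by
  have hAsub : A ⊆ Finset.Icc 0 b := fun a ha => Finset.mem_Icc.2 ⟨hmin a ha, hmax a ha⟩
  have hbℓ : (ℓ : ℤ) + 1 ≤ b := by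
    have h1 := Finset.card_le_card hAsub
    rw [Int.card_Icc] at h1
    omega
  have hb0 : 0 < b := by omega
  have hN1 : 1 ≤ N := by omega
  have h0' : 0 ∈ A.image (fun x => b - x) := Finset.mem_image.2 ⟨b, hb, sub_self b⟩
  ext n
  simp only [Finset.mem_coe, Set.mem_sdiff, Set.mem_Icc, Set.mem_union, not_or]
  constructor
  · intro hn
    refine ⟨⟨nonneg_of_mem_nfold hmin hn, le_of_mem_nfold hmax hn⟩, fun h => h.2 ⟨N, hN1, hn⟩, ?_⟩
    rintro ⟨m, hm, rfl⟩
    refine hm.2 ⟨N, hN1, ?_⟩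
    have := mem_nfold_reflect b hn
    rwa [sub_sub_cancel] at this
  · rintro ⟨⟨hn0, hnN⟩, hE, hE'⟩
    have key : ∀ (B : Finset ℤ) (m : ℤ), 0 ∈ B → 0 ≤ m → m ∉ postE B → ∃ M, m ∈ nfold B M := by
      intro B m hB hm hmE
      rcases hm.eq_or_lt with rfl | hm
      · exact ⟨0, by simp [nfold]⟩
      · by_contra hcon
        exact hmE ⟨hm, fun ⟨M, _, hM⟩ => hcon ⟨M, hM⟩⟩
    obtain ⟨M, hM⟩ := key A n h0 hn0 hE
    obtain ⟨M', hM'⟩ := key _ (b * N - n) h0' (by linarith)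
      fun h => hE' ⟨_, h, by simp⟩
    by_contra hcon
    obtain ⟨n', N', hNN', h1, h2, h3⟩ := exists_hole h0 hb hcon hM hM'
    have := hole_degree_lt hb0 h0 hb hmin hmax h1 h2 h3
    omega
end

section
/- Let ℓ ≥ 1 and A = {0 = a_0 < a_1 < ... < a_{ℓ+1} = b} be a finite set of integers with gcd(a_1, ..., a_{ℓ+1}) = 1. If N ≥ max(1, b − ℓ − 1), then NA = {0, 1, ..., bN} \ (E(A) ∪ (bN − E(b−A))), unless A or b−A equals {0,1,...,b} \ {a} for some a with 2 ≤ a ≤ b−2, or A or b−A equals {0,1} ∪ {a+1, a+2, ..., b} for some a with 2 ≤ a ≤ b−2. -/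
open Pointwise

/-- The list `L` of elements of `A` has sum congruent to `u` modulo `b` and, among all such lists,
minimizes first `p * length + q * sum` and then the length. -/
def IsMinRep (A : Finset ℤ) (b u p q : ℤ) (L : List ℤ) : Prop :=
  (∀ a ∈ L, a ∈ A) ∧ b ∣ L.sum - u ∧
    ∀ s : List ℤ, (∀ a ∈ s, a ∈ A) → b ∣ s.sum - u →
      p * L.length + q * L.sum ≤ p * s.length + q * s.sum ∧
      (p * s.length + q * s.sum = p * L.length + q * L.sum → L.length ≤ s.length)

theorem mem_nfold_iff_exists_list (A : Finset ℤ) (k : ℕ) (n : ℤ) :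
    n ∈ nfold A k ↔ ∃ s : List ℤ, s.length = k ∧ (∀ a ∈ s, a ∈ A) ∧ s.sum = n := by
  induction k generalizing n with
  | zero =>
    simp only [nfold, Finset.mem_singleton]
    constructor
    · rintro rfl
      exact ⟨[], by simp⟩
    · rintro ⟨s, hs, -, rfl⟩
      rw [List.length_eq_zero_iff] at hs
      simp [hs]
  | succ k ih =>
    simp only [nfold, Finset.mem_add]
    constructor
    · rintro ⟨m, hm, a, ha, rfl⟩
      obtain ⟨s, hs, hsA, rfl⟩ := (ih m).1 hm
      refine ⟨a :: s, by simp [hs], ?_, by simp [add_comm]⟩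
      simpa [ha] using hsA
    · rintro ⟨s, hs, hsA, rfl⟩
      match s, hs, hsA with
      | a :: s, hs, hsA =>
        refine ⟨s.sum, (ih _).2 ⟨s, by simpa using hs, fun x hx => hsA x (by simp [hx]), rfl⟩,
          a, hsA a (by simp), by simp [add_comm]⟩

theorem weight_nonneg {A : Finset ℤ} {p q : ℤ} (hw : ∀ a ∈ A, 0 ≤ p + q * a) (s : List ℤ)
    (hs : ∀ a ∈ s, a ∈ A) : 0 ≤ p * s.length + q * s.sum := by
  induction s with
  | nil => simp
  | cons a s ih =>
    have h1 := ih fun x hx => hs x (by simp [hx])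
    have h2 := hw a (hs a (by simp))
    simp only [List.length_cons, List.sum_cons]
    push_cast
    linarith

theorem exists_isMinRep {A : Finset ℤ} {b u p q : ℤ} (hw : ∀ a ∈ A, 0 ≤ p + q * a) (s : List ℤ)
    (hs : ∀ a ∈ s, a ∈ A) (hsu : b ∣ s.sum - u) : ∃ L, IsMinRep A b u p q L := by
  obtain ⟨L, ⟨hLA, hLu⟩, hL⟩ := WellFounded.has_min
    (InvImage.wf (fun s : List ℤ => toLex ((p * s.length + q * s.sum).toNat, s.length))
      (wellFounded_lt (α := ℕ ×ₗ ℕ)))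
    {s : List ℤ | (∀ a ∈ s, a ∈ A) ∧ b ∣ s.sum - u} ⟨s, hs, hsu⟩
  refine ⟨L, hLA, hLu, fun s hsA hsu => ?_⟩
  have h := hL s ⟨hsA, hsu⟩
  simp only [InvImage, Prod.Lex.toLex_lt_toLex, not_or, not_and, not_lt] at h
  have h1 := weight_nonneg hw s hsA
  have h2 := weight_nonneg hw L hLA
  obtain ⟨h3, h4⟩ := h
  exact ⟨by omega, fun e => h4 (by rw [e])⟩

theorem IsMinRep.perm {A : Finset ℤ} {b u p q : ℤ} {L L' : List ℤ} (h : IsMinRep A b u p q L)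
    (hp : L'.Perm L) : IsMinRep A b u p q L' := by
  obtain ⟨h1, h2, h3⟩ := h
  refine ⟨fun a ha => h1 a (hp.mem_iff.1 ha), by rwa [hp.sum_eq], ?_⟩
  rwa [hp.sum_eq, hp.length_eq]

theorem IsMinRep.eq_nil_of_dvd {A : Finset ℤ} {b u p q : ℤ} (hw : ∀ a ∈ A, 0 ≤ p + q * a)
    {P B R : List ℤ} (h : IsMinRep A b u p q (P ++ B ++ R)) (hB : b ∣ B.sum) : B = [] := by
  obtain ⟨h1, h2, h3⟩ := h
  have hBw := weight_nonneg hw B fun a ha => h1 a (by simp [ha])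
  have h4 := h3 (P ++ R) (fun a ha => h1 a (by
    simp only [List.mem_append] at ha ⊢; tauto)) (by
      obtain ⟨c, hc⟩ := dvd_sub h2 hB
      simp only [List.sum_append] at hc ⊢
      exact ⟨c, by linear_combination hc⟩)
  simp only [List.sum_append, List.length_append] at h4
  push_cast at h4
  obtain ⟨h5, h6⟩ := h4
  have h7 := h6 (by linarith)
  exact List.length_eq_zero_iff.1 (by omega)

theorem IsMinRep.pos_lt {A : Finset ℤ} {b u p q : ℤ} (hw : ∀ a ∈ A, 0 ≤ p + q * a)
    (hmin : ∀ a ∈ A, 0 ≤ a) (hmax : ∀ a ∈ A, a ≤ b)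
    {L : List ℤ} (h : IsMinRep A b u p q L) {a : ℤ} (ha : a ∈ L) : 0 < a ∧ a < b := by
  have h0 := hmin a (h.1 a ha)
  have h1 := hmax a (h.1 a ha)
  obtain ⟨P, R, rfl⟩ := List.append_of_mem ha
  have h2 : ¬ b ∣ a := fun hd => by
    have := IsMinRep.eq_nil_of_dvd hw (P := P) (B := [a]) (R := R) (by simpa using h) (by simpa)
    simp at this
  constructor
  · rcases h0.lt_or_eq with h | rfl
    · exact h
    · simp at h2
  · rcases h1.lt_or_eq with h | rfl
    · exact h
    · simp at h2

theorem IsMinRep.length_le_one_of_mem {A : Finset ℤ} {b u p q : ℤ}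
    (hw : ∀ a ∈ A, 0 ≤ p + q * a) (hp : b ∣ p)
    {P R : List ℤ} (h : IsMinRep A b u p q (P ++ R)) {a : ℤ} (ha : a ∈ A)
    (hlt : p + q * a < b) (hPa : b ∣ P.sum - a) : P.length ≤ 1 := by
  obtain ⟨h1, h2, h3⟩ := h
  have hPw := weight_nonneg hw P fun a ha => h1 a (by simp [ha])
  have h4 := h3 (a :: R) (by
    intro x hx
    rcases List.mem_cons.1 hx with rfl | hx
    · exact ha
    · exact h1 x (by simp [hx])) (by
      obtain ⟨c, hc⟩ := dvd_sub h2 hPa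
      simp only [List.sum_append, List.sum_cons] at hc ⊢
      exact ⟨c, by linear_combination hc⟩)
  have h5 : p + q * a ≤ p * P.length + q * P.sum := by
    obtain ⟨c, rfl⟩ := hp
    obtain ⟨d, hd⟩ := hPa
    have h6 : b * c * P.length + q * P.sum - (b * c + q * a) = b * (c * P.length + q * d - c) := by
      linear_combination q * hd
    have h7 : 0 < b := lt_of_le_of_lt (hw a ha) hlt
    have h8 : 0 ≤ c * P.length + q * d - c := by
      by_contra! hneg
      have := mul_le_mul_of_nonneg_left (Int.le_sub_one_of_lt hneg) h7.le
      linarith [hw a ha]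
    nlinarith [mul_nonneg h7.le h8]
  simp only [List.sum_append, List.length_append, List.sum_cons, List.length_cons] at h4
  push_cast at h4
  obtain ⟨h8, h9⟩ := h4
  have := h9 (by linarith)
  omega

theorem List.exists_split_of_le {α : Type*} (L : List α) {i j : ℕ} (hij : i ≤ j) :
    ∃ B, L.take j = L.take i ++ B ∧ L.drop i = B ++ L.drop j := by
  refine ⟨(L.drop i).take (j - i), ?_, ?_⟩
  · obtain ⟨k, rfl⟩ := Nat.exists_eq_add_of_le hij
    rw [List.take_add]; simp
  · obtain ⟨k, rfl⟩ := Nat.exists_eq_add_of_le hij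
    rw [← List.drop_drop]
    simp

/-- Prefix sums of a minimal representation are pairwise incongruent. -/
theorem IsMinRep.take_inj {A : Finset ℤ} {b u p q : ℤ} (hw : ∀ a ∈ A, 0 ≤ p + q * a)
    {C L : List ℤ} (h : IsMinRep A b u p q (C ++ L)) {i j : ℕ} (hi : i ≤ L.length)
    (hj : j ≤ L.length) (hd : b ∣ (L.take i).sum - (L.take j).sum) : i = j := by
  wlog hij : i ≤ j generalizing i j
  · exact (this hj hi (by rw [← dvd_neg]; simpa using hd) (by omega)).symm
  obtain ⟨B, hB, hB'⟩ := L.exists_split_of_le hij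
  have hL : C ++ L = (C ++ L.take i) ++ B ++ L.drop j := by
    conv_lhs => rw [← List.take_append_drop j L, hB]
    simp
  rw [hL] at h
  have := h.eq_nil_of_dvd hw (by rw [hB] at hd; simpa using hd)
  subst this
  have := congrArg List.length hB
  simp at this
  omega

theorem IsMinRep.of_sum_eq {A : Finset ℤ} {b u p q : ℤ} {L L' : List ℤ}
    (h : IsMinRep A b u p q L) (hA : ∀ a ∈ L', a ∈ A) (hs : L'.sum = L.sum)
    (hl : L'.length = L.length) : IsMinRep A b u p q L' := by
  obtain ⟨h1, h2, h3⟩ := h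
  refine ⟨hA, by rwa [hs], ?_⟩
  rwa [hs, hl]

theorem IsMinRep.exchange {A : Finset ℤ} {b u p q : ℤ} {P B R B' : List ℤ}
    (h : IsMinRep A b u p q (P ++ B ++ R)) (hB' : ∀ a ∈ B', a ∈ A)
    (hd : b ∣ B.sum - B'.sum) :
    p * B.length + q * B.sum ≤ p * B'.length + q * B'.sum ∧
      (p * B'.length + q * B'.sum = p * B.length + q * B.sum → B.length ≤ B'.length) := by
  obtain ⟨h1, h2, h3⟩ := h
  have h4 := h3 (P ++ B' ++ R) (fun a ha => by
    simp only [List.mem_append] at ha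
    rcases ha with (ha | ha) | ha
    · exact h1 a (by simp [ha])
    · exact hB' a ha
    · exact h1 a (by simp [ha])) (by
      obtain ⟨c, hc⟩ := dvd_sub h2 hd
      simp only [List.sum_append] at hc ⊢
      exact ⟨c, by linear_combination hc⟩)
  simp only [List.sum_append, List.length_append] at h4
  push_cast at h4
  refine ⟨by linarith [h4.1], fun e => ?_⟩
  have := h4.2 (by linarith)
  omega

/-- `C ++ L` minimizes the sum of elements of `A`, and `C ++ L'` minimizes the sum of their
reflections, in the class of `u` modulo `b`; the common part `C` is as long as possible. -/
structure IsReducedPair (A : Finset ℤ) (b u : ℤ) (C L L' : List ℤ) : Prop where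
  low : IsMinRep A b u 0 1 (C ++ L)
  high : IsMinRep A b u b (-1) (C ++ L')
  reduced : ∀ C₁ L₁ L₁' : List ℤ, IsMinRep A b u 0 1 (C₁ ++ L₁) →
    IsMinRep A b u b (-1) (C₁ ++ L₁') → L.length ≤ L₁.length

theorem IsReducedPair.perm {A : Finset ℤ} {b u : ℤ} {C L L' M M' : List ℤ}
    (h : IsReducedPair A b u C L L') (hM : M.Perm L) (hM' : M'.Perm L') :
    IsReducedPair A b u C M M' :=
  ⟨h.low.perm (hM.append_left C), h.high.perm (hM'.append_left C), fun C₁ L₁ L₁' h1 h2 => by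
    rw [hM.length_eq]
    exact h.reduced C₁ L₁ L₁' h1 h2⟩

theorem exists_isReducedPair {A : Finset ℤ} {b u : ℤ} {T T' : List ℤ}
    (hT : IsMinRep A b u 0 1 T) (hT' : IsMinRep A b u b (-1) T') :
    ∃ C L L', IsReducedPair A b u C L L' := by
  obtain ⟨⟨C, L, L'⟩, ⟨h1, h2⟩, h3⟩ := WellFounded.has_min
    (InvImage.wf (fun s : List ℤ × List ℤ × List ℤ => s.2.1.length) (wellFounded_lt (α := ℕ)))
    {s | IsMinRep A b u 0 1 (s.1 ++ s.2.1) ∧ IsMinRep A b u b (-1) (s.1 ++ s.2.2)}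
    ⟨([], T, T'), by simpa using hT, by simpa using hT'⟩
  exact ⟨C, L, L', h1, h2, fun C₁ L₁ L₁' h h' => not_lt.1 (h3 (C₁, L₁, L₁') ⟨h, h'⟩)⟩

theorem IsReducedPair.block_le {A : Finset ℤ} {b u : ℤ} {C P B R P' B' R' : List ℤ}
    (h : IsReducedPair A b u C (P ++ B ++ R) (P' ++ B' ++ R')) (hd : b ∣ B.sum - B'.sum) :
    B.sum ≤ B'.sum ∧ b * B'.length - B'.sum ≤ b * B.length - B.sum := by
  have hB : ∀ a ∈ B, a ∈ A := fun a ha => h.low.1 a (by simp [ha])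
  have hB' : ∀ a ∈ B', a ∈ A := fun a ha => h.high.1 a (by simp [ha])
  have h1 := (IsMinRep.exchange (P := C ++ P) (by simpa using h.low) hB' hd).1
  have h2 := (IsMinRep.exchange (P := C ++ P') (by simpa using h.high) hB
    (by rw [← dvd_neg]; simpa using hd)).1
  constructor <;> linarith

theorem IsReducedPair.block_lt {A : Finset ℤ} {b u : ℤ} (hb : 0 < b)
    {C P B R P' B' R' : List ℤ}
    (h : IsReducedPair A b u C (P ++ B ++ R) (P' ++ B' ++ R')) (hd : b ∣ B.sum - B'.sum)
    (hne : B ≠ []) :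
    B.sum < B'.sum ∧ b * B'.length - B'.sum < b * B.length - B.sum := by
  have hB : ∀ a ∈ B, a ∈ A := fun a ha => h.low.1 a (by simp [ha])
  have hB' : ∀ a ∈ B', a ∈ A := fun a ha => h.high.1 a (by simp [ha])
  have h1 := IsMinRep.exchange (P := C ++ P) (by simpa using h.low) hB' hd
  have h2 := IsMinRep.exchange (P := C ++ P') (by simpa using h.high) hB
    (by rw [← dvd_neg]; simpa using hd)
  have key : ¬ (B.sum = B'.sum ∧ B.length = B'.length) := by
    rintro ⟨e1, e2⟩
    have h3 := h.reduced (C ++ B') (P ++ R) (P' ++ R')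
      (h.low.of_sum_eq (fun a ha => by
        simp only [List.mem_append] at ha
        rcases ha with (ha | ha) | ha | ha
        · exact h.low.1 a (by simp [ha])
        · exact hB' a ha
        · exact h.low.1 a (by simp [ha])
        · exact h.low.1 a (by simp [ha]))
        (by simp only [List.sum_append]; linarith) (by simp only [List.length_append]; omega))
      (h.high.perm (by
        simp only [List.append_assoc]
        refine List.Perm.append_left C ?_
        rw [← List.append_assoc, ← List.append_assoc]
        exact List.Perm.append_right R' List.perm_append_comm))
    simp only [List.length_append] at h3
    exact hne (List.length_eq_zero_iff.1 (by omega))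
  have hle := h.block_le hd
  have hlen : ∀ m n : ℕ, b * m ≤ b * n → m ≤ n := fun m n hmn => by
    exact_mod_cast le_of_mul_le_mul_left hmn hb
  constructor
  · refine hle.1.lt_of_ne fun e => key ⟨e, ?_⟩
    exact le_antisymm (h1.2 (by simp [e])) (hlen _ _ (by linarith))
  · refine hle.2.lt_of_ne fun e => ?_
    have h3 := h2.2 (by linarith)
    have h4 := hlen B.length B'.length (by linarith)
    have h5 := le_antisymm h3 h4
    rw [h5] at e
    exact key ⟨by linarith, h5.symm⟩

theorem card_mul_le_of_injOn {ι : Type*} (S : Finset ι) (g : ι → ℤ) {b D : ℤ} (hb : 0 < b)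
    (hD : 0 ≤ D) (hbD : b ∣ D) (hinj : Set.InjOn g S)
    (hg : ∀ i ∈ S, b ∣ g i ∧ 0 ≤ g i ∧ g i < D) : b * S.card ≤ D := by
  obtain ⟨c, rfl⟩ := hbD
  have hc : 0 ≤ c := nonneg_of_mul_nonneg_right hD hb
  have h : S.card ≤ (Finset.Ico 0 c).card := by
    refine Finset.card_le_card_of_injOn (fun i => g i / b) ?_ ?_
    · intro i hi
      obtain ⟨⟨d, hd⟩, h1, h2⟩ := hg i hi
      simp only [Finset.coe_Ico, Set.mem_Ico]
      rw [hd] at h1 h2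
      rw [hd, Int.mul_ediv_cancel_left _ hb.ne']
      exact ⟨nonneg_of_mul_nonneg_right h1 hb, lt_of_mul_lt_mul_left h2 hb.le⟩
    · intro i hi j hj hij
      refine hinj hi hj ?_
      have h1 := Int.mul_ediv_cancel' (hg i hi).1
      have h2 := Int.mul_ediv_cancel' (hg j hj).1
      simp only at hij
      rw [← h1, ← h2, hij]
  rw [Int.card_Ico] at h
  have : (S.card : ℤ) ≤ c := by omega
  exact mul_le_mul_of_nonneg_left this hb.le

/-- Pairs of prefixes of `L` and `L'` whose sums agree modulo `b`. -/
def coincidences (b : ℤ) (L L' : List ℤ) : Finset (ℕ × ℕ) :=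
  (Finset.range (L.length + 1) ×ˢ Finset.range (L'.length + 1)).filter
    fun x => b ∣ (L.take x.1).sum - (L'.take x.2).sum

theorem mem_coincidences {b : ℤ} {L L' : List ℤ} {x : ℕ × ℕ} :
    x ∈ coincidences b L L' ↔ (x.1 ≤ L.length ∧ x.2 ≤ L'.length) ∧
      b ∣ (L.take x.1).sum - (L'.take x.2).sum := by
  simp [coincidences]

theorem weight_nonneg_low {A : Finset ℤ} (hmin : ∀ a ∈ A, 0 ≤ a) :
    ∀ a ∈ A, 0 ≤ 0 + 1 * a := by simpa using hmin

theorem weight_nonneg_high {A : Finset ℤ} {b : ℤ} (hmax : ∀ a ∈ A, a ≤ b) :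
    ∀ a ∈ A, 0 ≤ b + -1 * a := fun a ha => by linarith [hmax a ha]

theorem List.sum_nonneg_and_pos {b : ℤ} (B : List ℤ) (h : ∀ a ∈ B, 0 < a ∧ a < b) :
    0 ≤ B.sum ∧ 0 ≤ b * B.length - B.sum ∧
      (B ≠ [] → 0 < B.sum ∧ 0 < b * B.length - B.sum) := by
  induction B with
  | nil => simp
  | cons a B ih =>
    have h1 := ih fun x hx => h x (by simp [hx])
    have h2 := h a (by simp)
    simp only [List.sum_cons, List.length_cons]
    push_cast
    refine ⟨by linarith, by linarith, fun _ => ⟨by linarith, by linarith⟩⟩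

/-- The mixed sums attached to coincidences are monotone along each of the two lists. -/
theorem IsReducedPair.mixed_lt {A : Finset ℤ} {b u : ℤ} (hb : 0 < b)
    (hmin : ∀ a ∈ A, 0 ≤ a) (hmax : ∀ a ∈ A, a ≤ b) {C L L' : List ℤ}
    (h : IsReducedPair A b u C L L') {x y : ℕ × ℕ} (hx : x ∈ coincidences b L L')
    (hy : y ∈ coincidences b L L') (hxy : x.1 < y.1) :
    (L.take x.1).sum + (L'.drop x.2).sum ≠ (L.take y.1).sum + (L'.drop y.2).sum ∧
    (b * (L.take x.1).length - (L.take x.1).sum) +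
        (b * (L'.drop x.2).length - (L'.drop x.2).sum) ≠
      (b * (L.take y.1).length - (L.take y.1).sum) +
        (b * (L'.drop y.2).length - (L'.drop y.2).sum) := by
  rw [mem_coincidences] at hx hy
  obtain ⟨B, hB, hB2⟩ := L.exists_split_of_le hxy.le
  have hL : L = L.take x.1 ++ B ++ L.drop y.1 := by rw [← hB, List.take_append_drop]
  have hBne : B ≠ [] := by
    rintro rfl
    have := congrArg List.length hB
    simp at this
    omega
  have hBpos : ∀ a ∈ B, 0 < a ∧ a < b := fun a ha =>
    h.low.pos_lt (weight_nonneg_low hmin) hmin hmax (by rw [hL]; simp [ha])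
  have hBs := (B.sum_nonneg_and_pos hBpos).2.2 hBne
  rcases le_total x.2 y.2 with h2 | h2
  · obtain ⟨B', hB', hB2'⟩ := L'.exists_split_of_le h2
    have hL' : L' = L'.take x.2 ++ B' ++ L'.drop y.2 := by rw [← hB', List.take_append_drop]
    have h3 : IsReducedPair A b u C (L.take x.1 ++ B ++ L.drop y.1)
        (L'.take x.2 ++ B' ++ L'.drop y.2) := by rwa [← hL, ← hL']
    have h4 := h3.block_lt hb (by
      obtain ⟨c, hc⟩ := dvd_sub hy.2 hx.2
      rw [hB, hB'] at hc
      simp only [List.sum_append] at hc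
      exact ⟨c, by linear_combination hc⟩) hBne
    rw [hB, hB2']
    simp only [List.sum_append, List.length_append]
    push_cast
    constructor <;> intro e <;> linarith
  · obtain ⟨B', hB', hB2'⟩ := L'.exists_split_of_le h2
    have hL' : L' = L'.take y.2 ++ B' ++ L'.drop x.2 := by rw [← hB', List.take_append_drop]
    have hBs' := B'.sum_nonneg_and_pos (b := b) fun a ha =>
      h.high.pos_lt (weight_nonneg_high hmax) hmin hmax (by rw [hL']; simp [ha])
    rw [hB, hB2']
    simp only [List.sum_append, List.length_append]
    push_cast
    constructor <;> intro e <;> linarith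

theorem IsReducedPair.card_coincidences_le {A : Finset ℤ} {b u v : ℤ} (hb : 0 < b)
    (hmin : ∀ a ∈ A, 0 ≤ a) (hmax : ∀ a ∈ A, a ≤ b) {C L L' : List ℤ}
    (h : IsReducedPair A b u C L L') (huv : b ∣ u + v)
    (hlow : (C ++ L).sum ≤ u) (hhigh : b * (C ++ L').length - (C ++ L').sum ≤ v)
    (hfail : ∀ s : List ℤ, (∀ a ∈ s, a ∈ A) → b ∣ s.sum - u → s.sum ≤ u →
      ¬ b * s.length - s.sum ≤ v) :
    b * (coincidences b L L').card ≤
      ((C ++ L').sum - u) + (b * (C ++ L).length - (C ++ L).sum - v) := by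
  have hinj : ∀ x ∈ coincidences b L L', ∀ y ∈ coincidences b L L',
      ((L.take x.1).sum + (L'.drop x.2).sum = (L.take y.1).sum + (L'.drop y.2).sum ∨
      (b * (L.take x.1).length - (L.take x.1).sum) +
        (b * (L'.drop x.2).length - (L'.drop x.2).sum) =
      (b * (L.take y.1).length - (L.take y.1).sum) +
        (b * (L'.drop y.2).length - (L'.drop y.2).sum)) → x = y := by
    intro x hx y hy hxy
    rcases lt_trichotomy x.1 y.1 with hlt | heq | hlt
    · have := h.mixed_lt hb hmin hmax hx hy hlt
      tauto
    · rw [mem_coincidences] at hx hy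
      refine Prod.ext heq (h.high.take_inj (weight_nonneg_high hmax) hx.1.2 hy.1.2 ?_)
      have := dvd_sub hy.2 hx.2
      rw [heq] at this
      simpa using this
    · have := h.mixed_lt hb hmin hmax hy hx hlt
      rw [eq_comm, eq_comm (a := b * _ - _ + _)] at hxy
      tauto
  have hD : u < (C ++ L').sum := by
    by_contra! hle
    exact hfail _ h.high.1 h.high.2.1 hle hhigh
  have hE : v < b * (C ++ L).length - (C ++ L).sum := by
    by_contra! hle
    exact hfail _ h.low.1 h.low.2.1 hlow hle
  have hbE : b ∣ b * (C ++ L).length - (C ++ L).sum - v := by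
    obtain ⟨c, hc⟩ := h.low.2.1
    obtain ⟨d, hd⟩ := huv
    exact ⟨(C ++ L).length - c - d, by linear_combination -hc - hd⟩
  set Q := coincidences b L L' with hQ
  let p : ℕ × ℕ → Prop := fun x => u < C.sum + ((L.take x.1).sum + (L'.drop x.2).sum)
  have hsplit : (Q.filter p).card + (Q.filter fun x => ¬ p x).card = Q.card :=
    Finset.card_filter_add_card_filter_not p
  have hmem : ∀ x ∈ Q, b ∣ L'.sum - ((L.take x.1).sum + (L'.drop x.2).sum) ∧
      0 ≤ L'.sum - ((L.take x.1).sum + (L'.drop x.2).sum) ∧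
      b ∣ (b * L.length - L.sum) - ((b * (L.take x.1).length - (L.take x.1).sum) +
        (b * (L'.drop x.2).length - (L'.drop x.2).sum)) ∧
      0 ≤ (b * L.length - L.sum) - ((b * (L.take x.1).length - (L.take x.1).sum) +
        (b * (L'.drop x.2).length - (L'.drop x.2).sum)) := by
    intro x hx
    rw [hQ, mem_coincidences] at hx
    have e1 : L.sum = (L.take x.1).sum + (L.drop x.1).sum := by
      rw [← List.sum_append, List.take_append_drop]
    have e2 : L'.sum = (L'.take x.2).sum + (L'.drop x.2).sum := by
      rw [← List.sum_append, List.take_append_drop]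
    have e3 : (L.length : ℤ) = (L.take x.1).length + (L.drop x.1).length := by
      rw [← Nat.cast_add, ← List.length_append, List.take_append_drop]
    have hd : b ∣ (L.drop x.1).sum - (L'.drop x.2).sum := by
      obtain ⟨c, hc⟩ := dvd_sub (dvd_sub h.low.2.1 h.high.2.1) hx.2
      simp only [List.sum_append] at hc
      exact ⟨c, by linear_combination hc - e1 + e2⟩
    have f1 := (IsReducedPair.block_le (P := []) (B := L.take x.1) (R := L.drop x.1)
      (P' := []) (B' := L'.take x.2) (R' := L'.drop x.2) (by simpa using h) hx.2).1
    have f2 := (IsReducedPair.block_le (P := L.take x.1) (B := L.drop x.1) (R := [])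
      (P' := L'.take x.2) (B' := L'.drop x.2) (R' := []) (by simpa using h) hd).2
    refine ⟨?_, by linarith, ?_, by rw [e3, e1]; linarith⟩
    · obtain ⟨c, hc⟩ := hx.2
      exact ⟨-c, by linear_combination e2 - hc⟩
    · obtain ⟨c, hc⟩ := hd
      refine ⟨(L.drop x.1).length - (L'.drop x.2).length - c, ?_⟩
      rw [e3, e1]
      linear_combination -hc
  have h1 : b * (Q.filter p).card ≤ (C ++ L').sum - u := by
    refine card_mul_le_of_injOn _
      (fun x => L'.sum - ((L.take x.1).sum + (L'.drop x.2).sum)) hb (by linarith)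
      h.high.2.1 ?_ ?_
    · intro x hx y hy hxy
      simp only [Finset.coe_filter, Set.mem_ofPred_eq] at hx hy
      exact hinj x hx.1 y hy.1 (Or.inl (by linarith))
    · intro x hx
      rw [Finset.mem_filter] at hx
      have := hmem x hx.1
      refine ⟨this.1, this.2.1, ?_⟩
      have := hx.2
      simp only [p] at this
      simp only [List.sum_append]
      linarith
  have h2 : b * (Q.filter fun x => ¬ p x).card ≤
      b * (C ++ L).length - (C ++ L).sum - v := by
    refine card_mul_le_of_injOn _
      (fun x => (b * L.length - L.sum) - ((b * (L.take x.1).length - (L.take x.1).sum) +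
        (b * (L'.drop x.2).length - (L'.drop x.2).sum))) hb (by linarith) hbE ?_ ?_
    · intro x hx y hy hxy
      simp only [Finset.coe_filter, Set.mem_ofPred_eq] at hx hy
      exact hinj x hx.1 y hy.1 (Or.inr (by simp only at hxy; linarith))
    · intro x hx
      rw [Finset.mem_filter] at hx
      have h3 := hmem x hx.1
      refine ⟨h3.2.2.1, h3.2.2.2, ?_⟩
      have h4 := hfail (C ++ L.take x.1 ++ L'.drop x.2) (fun a ha => by
        simp only [List.mem_append] at ha
        rcases ha with (ha | ha) | ha
        · exact h.low.1 a (by simp [ha])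
        · exact h.low.1 a (List.mem_append_right _ (List.mem_of_mem_take ha))
        · exact h.high.1 a (List.mem_append_right _ (List.mem_of_mem_drop ha))) (by
          obtain ⟨c, hc⟩ := dvd_sub h.high.2.1 h3.1
          simp only [List.sum_append] at hc ⊢
          exact ⟨c, by linear_combination hc⟩) (by
          have := hx.2
          simp only [p, not_lt] at this
          simp only [List.sum_append]
          linarith)
      simp only [List.sum_append, List.length_append] at h4 ⊢
      push_cast at h4 ⊢
      linarith
  rw [← hsplit]
  push_cast
  linarith

/-- The residues modulo `b` of the prefix sums of `T`. -/
def prefixResidues (b : ℤ) (T : List ℤ) : Finset ℤ :=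
  (Finset.range (T.length + 1)).image fun i => (T.take i).sum % b

theorem mem_prefixResidues {b : ℤ} {T : List ℤ} {z : ℤ} :
    z ∈ prefixResidues b T ↔ ∃ i ≤ T.length, (T.take i).sum % b = z := by
  simp [prefixResidues]

theorem IsMinRep.card_prefixResidues {A : Finset ℤ} {b u p q : ℤ}
    (hw : ∀ a ∈ A, 0 ≤ p + q * a) {T : List ℤ} (h : IsMinRep A b u p q T) :
    (prefixResidues b T).card = T.length + 1 := by
  rw [prefixResidues, Finset.card_image_of_injOn, Finset.card_range]
  intro i hi j hj hij
  simp only [Finset.coe_range, Set.mem_Iio] at hi hj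
  exact IsMinRep.take_inj (C := []) hw (by simpa using h) (by omega) (by omega)
    (Int.ModEq.dvd (Eq.symm hij))

theorem IsMinRep.prefixResidues_subset {A : Finset ℤ} {b u p q : ℤ} (hb : 0 < b)
    (hw : ∀ a ∈ A, 0 ≤ p + q * a) (hp : b ∣ p) (hlt : ∀ a, 0 < a → a < b → p + q * a < b)
    {T : List ℤ} (h : IsMinRep A b u p q T) :
    prefixResidues b T ⊆ insert 0 (insert ((T.take 1).sum % b) (Finset.Icc 0 b \ A)) := by
  intro z hz
  obtain ⟨i, hi, rfl⟩ := mem_prefixResidues.1 hz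
  simp only [Finset.mem_insert, Finset.mem_sdiff, Finset.mem_Icc]
  have h1 := Int.emod_nonneg (T.take i).sum hb.ne'
  have h2 := Int.emod_lt_of_pos (T.take i).sum hb
  by_contra! hcon
  obtain ⟨h3, h4, h5⟩ := hcon
  have h6 := h5 ⟨h1, h2.le⟩
  have h7 := IsMinRep.length_le_one_of_mem (P := T.take i) (R := T.drop i) hw hp
    (by rwa [List.take_append_drop]) h6 (hlt _ (lt_of_le_of_ne h1 (Ne.symm h3)) h2)
    (Int.dvd_self_sub_emod)
  rw [List.length_take, min_eq_left hi] at h7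
  interval_cases i
  · simp at h3
  · exact h4 rfl

theorem IsReducedPair.card_add_card_le {A : Finset ℤ} {b u : ℤ}
    (hmin : ∀ a ∈ A, 0 ≤ a) (hmax : ∀ a ∈ A, a ≤ b) {C L L' : List ℤ}
    (h : IsReducedPair A b u C L L') :
    ((C ++ L).length + 1) + ((C ++ L').length + 1) ≤
      (prefixResidues b (C ++ L) ∪ prefixResidues b (C ++ L')).card + C.length +
        (coincidences b L L').card := by
  rw [← h.low.card_prefixResidues (weight_nonneg_low hmin),
    ← h.high.card_prefixResidues (weight_nonneg_high hmax), ← Finset.card_union_add_card_inter,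
    add_assoc]
  refine Nat.add_le_add_left ?_ _
  have hsub : prefixResidues b (C ++ L) ∩ prefixResidues b (C ++ L') ⊆
      ((Finset.range C.length).image fun i => (C.take i).sum % b) ∪
        ((coincidences b L L').image fun x => (C.sum + (L.take x.1).sum) % b) := by
    intro z hz
    rw [Finset.mem_inter, mem_prefixResidues, mem_prefixResidues] at hz
    obtain ⟨⟨i, hi, hiz⟩, j, hj, hjz⟩ := hz
    rw [List.length_append] at hi hj
    rw [Finset.mem_union, Finset.mem_image, Finset.mem_image]
    by_cases hiC : i < C.length
    · exact Or.inl ⟨i, by simpa using hiC, by rw [← hiz, List.take_append_of_le_length hiC.le]⟩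
    by_cases hjC : j < C.length
    · exact Or.inl ⟨j, by simpa using hjC, by rw [← hjz, List.take_append_of_le_length hjC.le]⟩
    obtain ⟨i, rfl⟩ := Nat.exists_eq_add_of_le (not_lt.1 hiC)
    obtain ⟨j, rfl⟩ := Nat.exists_eq_add_of_le (not_lt.1 hjC)
    rw [List.take_length_add_append, List.sum_append] at hiz hjz
    refine Or.inr ⟨(i, j), mem_coincidences.2 ⟨⟨by simpa using hi, by simpa using hj⟩, ?_⟩, hiz⟩
    have := Int.ModEq.dvd (n := b) (hjz.trans hiz.symm)
    simpa using this
  refine (Finset.card_le_card hsub).trans ((Finset.card_union_le _ _).trans ?_)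
  refine add_le_add ?_ Finset.card_image_le
  exact Finset.card_image_le.trans (by simp)

/-- A class in which the structure theorem fails for `N` at least the number of missing elements
is extremal. -/
theorem IsReducedPair.extremal {A : Finset ℤ} {b u v : ℤ} {N : ℕ} (hb : 0 < b)
    (hmin : ∀ a ∈ A, 0 ≤ a) (hmax : ∀ a ∈ A, a ≤ b) {C L L' : List ℤ}
    (h : IsReducedPair A b u C L L') (huv : u + v = b * N)
    (hlow : (C ++ L).sum ≤ u) (hhigh : b * (C ++ L').length - (C ++ L').sum ≤ v)
    (hfail : ∀ s : List ℤ, (∀ a ∈ s, a ∈ A) → b ∣ s.sum - u → s.sum ≤ u →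
      ¬ b * s.length - s.sum ≤ v)
    (hN : (Finset.Icc 0 b \ A).card ≤ N) :
    C = [] ∧ L.sum + (b * L'.length - L'.sum) = b ∧
      Finset.Icc 0 b \ A ⊆ prefixResidues b L ∪ prefixResidues b L' := by
  set S := prefixResidues b (C ++ L) ∪ prefixResidues b (C ++ L') with hS
  set H := Finset.Icc 0 b \ A with hH
  have hcard := h.card_add_card_le hmin hmax
  have hQ := h.card_coincidences_le hb hmin hmax ⟨N, huv⟩ hlow hhigh hfail
  rw [← hS] at hcard
  have hL := L.sum_nonneg_and_pos (b := b) fun a ha =>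
    h.low.pos_lt (weight_nonneg_low hmin) hmin hmax (List.mem_append_right C ha)
  have hL' := L'.sum_nonneg_and_pos (b := b) fun a ha =>
    h.high.pos_lt (weight_nonneg_high hmax) hmin hmax (List.mem_append_right C ha)
  obtain ⟨M, hM⟩ : b ∣ L.sum + (b * L'.length - L'.sum) := by
    obtain ⟨c, hc⟩ := dvd_sub h.low.2.1 h.high.2.1
    simp only [List.sum_append] at hc
    exact ⟨c + L'.length, by linear_combination hc⟩
  have hMpos : 0 < M := by
    refine pos_of_mul_pos_right (a := b) ?_ hb.le
    rw [← hM]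
    by_contra! hle
    have e1 : L = [] := by
      by_contra hne
      linarith [hL.2.2 hne, (hL.2.2 hne).1]
    have e2 : L' = [] := by
      by_contra hne
      linarith [hL'.2.2 hne, (hL'.2.2 hne).2]
    subst e1 e2
    exact hfail _ h.low.1 h.low.2.1 hlow hhigh
  have hmain : N + M + 2 ≤ S.card := by
    have h1 : ((C.length + L.length + 1 + (C.length + L'.length + 1) : ℕ) : ℤ) ≤
        ((S.card + C.length + (coincidences b L L').card : ℕ) : ℤ) := by
      simp only [List.length_append] at hcard
      exact_mod_cast hcard
    have h2 := mul_le_mul_of_nonneg_left h1 hb.le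
    simp only [List.sum_append, List.length_append] at hQ
    push_cast at h2 hQ
    refine le_of_mul_le_mul_left (a := b) ?_ hb
    linarith
  have hsub1 := h.low.prefixResidues_subset hb (weight_nonneg_low hmin) (dvd_zero b)
    (fun a _ ha => by linarith)
  have hsub2 := h.high.prefixResidues_subset hb (weight_nonneg_high hmax) (dvd_refl b)
    (fun a ha _ => by linarith)
  have hsub : S ⊆ insert 0 (insert (((C ++ L).take 1).sum % b)
      (insert (((C ++ L').take 1).sum % b) H)) := by
    intro z hz
    rcases Finset.mem_union.1 hz with hz | hz
    · have := hsub1 hz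
      simp only [Finset.mem_insert] at this ⊢
      tauto
    · have := hsub2 hz
      simp only [Finset.mem_insert] at this ⊢
      tauto
  have hC : C = [] := by
    by_contra hne
    have e : ∀ K : List ℤ, (C ++ K).take 1 = C.take 1 := fun K =>
      List.take_append_of_le_length (List.length_pos_iff.2 hne)
    rw [e, e, Finset.insert_idem] at hsub
    have h1 := Finset.card_le_card hsub
    have h2 := Finset.card_insert_le (0 : ℤ) (insert ((C.take 1).sum % b) H)
    have h3 := Finset.card_insert_le ((C.take 1).sum % b) H
    omega
  subst hC
  have h1 := Finset.card_insert_le (0 : ℤ) (insert ((([] ++ L).take 1).sum % b)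
      (insert ((([] ++ L').take 1).sum % b) H))
  have h2 := Finset.card_insert_le ((([] ++ L).take 1).sum % b)
      (insert ((([] ++ L').take 1).sum % b) H)
  have h3 := Finset.card_insert_le ((([] ++ L').take 1).sum % b) H
  have h4 := Finset.card_le_card hsub
  have hM1 : M = 1 := by omega
  refine ⟨rfl, by rw [hM, hM1, mul_one], ?_⟩
  have := Finset.eq_of_subset_of_card_le hsub (by omega)
  simp only [List.nil_append] at hS this
  rw [← hS, this]
  intro z hz
  simp [hz]

theorem List.sum_map_const_sub (b : ℤ) (s : List ℤ) :
    (s.map fun x => b - x).sum = b * s.length - s.sum := by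
  induction s with
  | nil => simp
  | cons a s ih =>
    simp only [List.map_cons, List.sum_cons, List.length_cons, ih]
    push_cast
    ring

theorem List.sum_take_bounds {b : ℤ} {K : List ℤ} (h : ∀ a ∈ K, 0 < a ∧ a < b) (i : ℕ) :
    0 ≤ (K.take i).sum ∧ (K.take i).sum ≤ K.sum ∧
      0 ≤ b * (K.take i).length - (K.take i).sum ∧
      b * (K.take i).length - (K.take i).sum ≤ b * K.length - K.sum := by
  have h1 := (K.take i).sum_nonneg_and_pos fun a ha => h a (List.mem_of_mem_take ha)
  have h2 := (K.drop i).sum_nonneg_and_pos fun a ha => h a (List.mem_of_mem_drop ha)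
  have e1 : K.sum = (K.take i).sum + (K.drop i).sum := by
    rw [← List.sum_append, List.take_append_drop]
  have e2 : (K.length : ℤ) = (K.take i).length + (K.drop i).length := by
    rw [← Nat.cast_add, ← List.length_append, List.take_append_drop]
  refine ⟨h1.1, by linarith, h1.2.1, ?_⟩
  rw [e1, e2]
  linarith

/-- If every integer up to `L.sum` missing from `A` is a prefix sum of every rearrangement of the
shortest representation `L`, then the missing integers are very restricted. -/
theorem missing_dichotomy {A : Finset ℤ} {b : ℤ} {L : List ℤ} (hA : ∀ a ∈ L, a ∈ A)
    (hpos : ∀ a ∈ L, 0 < a) (hxpos : 0 < L.sum) (hxb : L.sum < b) (hx : L.sum ∉ A)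
    (hlen : ∀ s : List ℤ, (∀ a ∈ s, a ∈ A) → s.sum = L.sum → L.length ≤ s.length)
    (hcov : ∀ K : List ℤ, K.Perm L → ∀ z, 0 < z → z < b → z ∉ A → z ≤ L.sum →
      ∃ i, (K.take i).sum = z) :
    2 ≤ L.sum ∧ ((∀ z, 0 < z → z < L.sum → z ∈ A) ∨
      (1 ∈ A ∧ ∀ z, 2 ≤ z → z ≤ L.sum → z ∉ A)) := by
  match L, hA, hpos, hxpos, hxb, hx, hlen, hcov with
  | [], _, _, hxpos, _, _, _, _ => simp at hxpos
  | [a], hA, _, _, _, hx, _, _ => simp at hA hx; exact absurd hA hx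
  | [a, c], hA, hpos, hxpos, hxb, hx, hlen, hcov =>
    have h1 := hpos a (by simp)
    have h2 := hpos c (by simp)
    simp only [List.sum_cons, List.sum_nil, add_zero] at *
    refine ⟨by omega, Or.inl fun z hz hzx => ?_⟩
    by_contra hzA
    obtain ⟨i, rfl⟩ := hcov [a, c] (List.Perm.refl _) z hz (by omega) hzA hzx.le
    match i with
    | 0 => simp at hz
    | 1 => simp at hzA; exact hzA (hA a (by simp))
    | i + 2 => simp at hzx
  | a :: c :: d :: L, hA, hpos, hxpos, hxb, hx, hlen, hcov =>
    set T := a :: c :: d :: L with hT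
    have hTlen : 3 ≤ T.length := by simp [hT]
    have hle : ∀ s₁ s₂ r₁ r₂ : ℤ, ∀ S R : List ℤ, (s₁ :: s₂ :: S).Perm T →
        (r₁ :: r₂ :: R).Perm T → r₁ + r₂ ≤ s₁ + s₂ := by
      intro s₁ s₂ r₁ r₂ S R hS hR
      have hSm : ∀ x ∈ s₁ :: s₂ :: S, x ∈ A ∧ 0 < x := fun x hx =>
        ⟨hA x (hS.mem_iff.1 hx), hpos x (hS.mem_iff.1 hx)⟩
      have hRm : ∀ x ∈ r₁ :: r₂ :: R, x ∈ A ∧ 0 < x := fun x hx =>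
        ⟨hA x (hR.mem_iff.1 hx), hpos x (hR.mem_iff.1 hx)⟩
      have hSs := hS.sum_eq
      have hSl := hS.length_eq
      simp only [List.sum_cons, List.length_cons] at hSs hSl
      have hS0 : 0 ≤ S.sum := List.sum_nonneg fun x hx => (hSm x (by simp [hx])).2.le
      have hs1 := (hSm s₁ (by simp)).2
      have hs2 := (hSm s₂ (by simp)).2
      have hnot : s₁ + s₂ ∉ A := fun hmem => by
        have := hlen ((s₁ + s₂) :: S) (by
          intro x hx
          rcases List.mem_cons.1 hx with rfl | hx
          · exact hmem
          · exact (hSm x (by simp [hx])).1) (by simp only [List.sum_cons]; linarith)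
        simp only [List.length_cons] at this
        omega
      obtain ⟨i, hi⟩ := hcov _ hR (s₁ + s₂) (by omega) (by omega) hnot (by omega)
      match i with
      | 0 => simp at hi; omega
      | 1 =>
        simp at hi
        exact absurd (hi ▸ (hRm r₁ (by simp)).1) hnot
      | i + 2 =>
        simp only [List.take_succ_cons, List.sum_cons] at hi
        have : 0 ≤ (R.take i).sum := List.sum_nonneg fun x hx =>
          (hRm x (by simp [List.mem_of_mem_take hx])).2.le
        omega
    have hp1 : (a :: c :: d :: L).Perm T := List.Perm.refl _
    have hp2 : (a :: d :: c :: L).Perm T := (List.Perm.swap c d L).cons a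
    have hp3 : (c :: d :: a :: L).Perm T :=
      ((List.Perm.swap a d L).cons c).trans (List.Perm.swap a c (d :: L))
    have hcd : c = d := by
      have h1 := hle _ _ _ _ _ _ hp1 hp2
      have h2 := hle _ _ _ _ _ _ hp2 hp1
      omega
    have had : a = d := by
      have h1 := hle _ _ _ _ _ _ hp1 hp3
      have h2 := hle _ _ _ _ _ _ hp3 hp1
      omega
    have hall : ∀ e ∈ T, e = a := by
      intro e he
      simp only [hT, List.mem_cons] at he
      rcases he with rfl | rfl | rfl | he
      · rfl
      · omega
      · exact had.symm
      · have hp4 : (a :: e :: c :: d :: L.erase e).Perm T := by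
          refine List.Perm.cons a ?_
          have := (List.perm_cons_erase he).symm
          refine List.Perm.trans ?_ ((this.cons d).cons c)
          exact (List.Perm.swap c e _).trans ((List.Perm.swap d e _).cons c)
        have h1 := hle _ _ _ _ _ _ hp1 hp4
        have h2 := hle _ _ _ _ _ _ hp4 hp1
        omega
    have hrep : T = List.replicate T.length a := List.eq_replicate_of_mem hall
    have ha0 : 0 < a := hpos a (by simp [hT])
    have haA : a ∈ A := hA a (by simp [hT])
    have hsum : T.sum = T.length * a := by
      conv_lhs => rw [hrep]
      simp
    have hge : (3 : ℤ) ≤ T.length := by exact_mod_cast hTlen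
    have hdvd : ∀ z, 0 < z → z ≤ T.sum → z ∉ A → a ∣ z := by
      intro z hz hzT hzA
      obtain ⟨i, rfl⟩ := hcov T (List.Perm.refl _) z hz (by omega) hzA hzT
      rw [hrep, List.take_replicate]
      simp
    have h3 : 3 * a ≤ T.sum := by rw [hsum]; exact mul_le_mul_of_nonneg_right hge ha0.le
    have ha1 : a = 1 := by
      by_contra hne
      have h1A : (1 : ℤ) ∈ A := by
        by_contra hn
        exact hne (Int.eq_one_of_dvd_one ha0.le (hdvd 1 one_pos (by omega) hn))
      have h2A : T.sum - 1 ∈ A := by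
        by_contra hn
        have h5 := hdvd (T.sum - 1) (by omega) (by omega) hn
        have h6 : a ∣ T.sum := hsum ▸ Dvd.intro_left _ rfl
        have := dvd_sub h6 h5
        rw [sub_sub_cancel] at this
        exact hne (Int.eq_one_of_dvd_one ha0.le this)
      have := hlen [T.sum - 1, 1] (by simp [h1A, h2A]) (by simp)
      simp only [List.length_cons, List.length_nil] at this
      omega
    rw [ha1] at haA hsum
    refine ⟨by omega, Or.inr ⟨haA, fun z hz hzT hzA => ?_⟩⟩
    have := hlen (z :: List.replicate (T.length - z.toNat) 1) (by
      intro x hx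
      rcases List.mem_cons.1 hx with rfl | hx
      · exact hzA
      · rw [List.eq_of_mem_replicate hx]; exact haA) (by
      simp only [List.sum_cons, List.sum_replicate, nsmul_eq_mul, mul_one]
      omega)
    simp only [List.length_cons, List.length_replicate] at this
    omega

theorem IsReducedPair.exists_take_sum_eq {A : Finset ℤ} {b u v : ℤ} {N : ℕ} (hb : 0 < b)
    (hmin : ∀ a ∈ A, 0 ≤ a) (hmax : ∀ a ∈ A, a ≤ b) {L L' : List ℤ}
    (h : IsReducedPair A b u [] L L') (huv : u + v = b * N)
    (hlow : L.sum ≤ u) (hhigh : b * L'.length - L'.sum ≤ v)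
    (hfail : ∀ s : List ℤ, (∀ a ∈ s, a ∈ A) → b ∣ s.sum - u → s.sum ≤ u →
      ¬ b * s.length - s.sum ≤ v)
    (hN : (Finset.Icc 0 b \ A).card ≤ N) (hL : L.sum < b) (hL' : b * L'.length - L'.sum < b)
    {z : ℤ} (hz : 0 < z) (hzb : z < b) (hzA : z ∉ A) :
    (∃ i, (L.take i).sum = z) ∨
      ∃ j, b * (L'.take j).length - (L'.take j).sum = b - z := by
  have hlt := fun a ha => h.low.pos_lt (weight_nonneg_low hmin) hmin hmax (a := a)
    (List.mem_append_right [] ha)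
  have hlt' := fun a ha => h.high.pos_lt (weight_nonneg_high hmax) hmin hmax (a := a)
    (List.mem_append_right [] ha)
  have hmem := (h.extremal hb hmin hmax huv hlow hhigh hfail hN).2.2
    (show z ∈ Finset.Icc 0 b \ A by simp [hz.le, hzb.le, hzA])
  rcases Finset.mem_union.1 hmem with hm | hm
  · obtain ⟨i, -, hi⟩ := mem_prefixResidues.1 hm
    have hbd := List.sum_take_bounds hlt i
    rw [Int.emod_eq_of_lt hbd.1 (by omega)] at hi
    exact Or.inl ⟨i, hi⟩
  · obtain ⟨j, -, hj⟩ := mem_prefixResidues.1 hm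
    have hbd := List.sum_take_bounds hlt' j
    refine Or.inr ⟨j, ?_⟩
    set w := b * ((L'.take j).length : ℤ) - (L'.take j).sum with hw
    have e : (L'.take j).sum = (b - w) + b * ((L'.take j).length - 1) := by rw [hw]; ring
    rw [e, Int.add_mul_emod_self_left] at hj
    rcases hbd.2.2.1.eq_or_lt with h0 | h0
    · rw [← h0] at hj
      simp at hj
      omega
    · rw [Int.emod_eq_of_lt (by omega) (by omega)] at hj
      omega

/-- The exceptional sets of the structure theorem. -/
def IsExceptional (A : Finset ℤ) (b : ℤ) : Prop :=
  ∃ a : ℤ, 2 ≤ a ∧ a ≤ b - 2 ∧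
    (A = Finset.Icc 0 b \ {a} ∨
     A.image (fun x => b - x) = Finset.Icc 0 b \ {a} ∨
     A = {0, 1} ∪ Finset.Icc (a + 1) b ∨
     A.image (fun x => b - x) = {0, 1} ∪ Finset.Icc (a + 1) b)

theorem mem_image_const_sub {A : Finset ℤ} {b z : ℤ} :
    z ∈ A.image (fun x => b - x) ↔ b - z ∈ A := by
  rw [Finset.mem_image]
  constructor
  · rintro ⟨x, hx, rfl⟩
    simpa using hx
  · exact fun h => ⟨b - z, h, by ring⟩

theorem isExceptional_of_missing {A : Finset ℤ} {b x : ℤ} (h0 : 0 ∈ A) (hb : b ∈ A)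
    (hmin : ∀ a ∈ A, 0 ≤ a) (hmax : ∀ a ∈ A, a ≤ b) (hx2 : 2 ≤ x) (hxb : x ≤ b - 2)
    (hx : x ∉ A)
    (hlow : (∀ z, 0 < z → z < x → z ∈ A) ∨ (1 ∈ A ∧ ∀ z, 2 ≤ z → z ≤ x → z ∉ A))
    (hhigh : (∀ z, x < z → z < b → z ∈ A) ∨
      (b - 1 ∈ A ∧ ∀ z, x ≤ z → z ≤ b - 2 → z ∉ A)) : IsExceptional A b := by
  have hmem : ∀ z, z ∈ A → z = 0 ∨ z = 1 ∨ (2 ≤ z ∧ z < x) ∨ (x < z ∧ z ≤ b - 2) ∨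
      z = b - 1 ∨ z = b := fun z hz => by
    have h1 := hmin z hz
    have h2 := hmax z hz
    have h3 : z ≠ x := fun e => hx (e ▸ hz)
    omega
  rcases hlow with hl | ⟨h1, hl⟩ <;> rcases hhigh with hh | ⟨h1', hh⟩
  · refine ⟨x, hx2, hxb, Or.inl ?_⟩
    ext z
    simp only [Finset.mem_sdiff, Finset.mem_Icc, Finset.mem_singleton]
    refine ⟨fun hz => ⟨⟨hmin z hz, hmax z hz⟩, fun e => hx (e ▸ hz)⟩, ?_⟩
    rintro ⟨⟨hz0, hzb⟩, hzx⟩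
    rcases hz0.eq_or_lt with rfl | hz0
    · exact h0
    rcases hzb.eq_or_lt with rfl | hzb
    · exact hb
    rcases lt_or_gt_of_ne hzx with hlt | hlt
    · exact hl z hz0 hlt
    · exact hh z hlt hzb
  · refine ⟨b - x, by omega, by omega, Or.inr (Or.inr (Or.inr ?_))⟩
    ext z
    simp only [mem_image_const_sub, Finset.mem_union, Finset.mem_Icc, Finset.mem_insert,
      Finset.mem_singleton]
    constructor
    · intro hz
      have h3 := hmem _ hz
      have h4 : ¬ (x ≤ b - z ∧ b - z ≤ b - 2) := fun h5 => hh _ h5.1 h5.2 hz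
      omega
    · rintro ((rfl | rfl) | ⟨h3, h4⟩)
      · simpa using hb
      · exact h1'
      · rcases h4.eq_or_lt with rfl | h4
        · simpa using h0
        · exact hl _ (by omega) (by omega)
  · refine ⟨x, hx2, hxb, Or.inr (Or.inr (Or.inl ?_))⟩
    ext z
    simp only [Finset.mem_union, Finset.mem_Icc, Finset.mem_insert, Finset.mem_singleton]
    constructor
    · intro hz
      have h3 := hmem _ hz
      have h4 : ¬ (2 ≤ z ∧ z ≤ x) := fun h5 => hl _ h5.1 h5.2 hz
      omega
    · rintro ((rfl | rfl) | ⟨h3, h4⟩)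
      · exact h0
      · exact h1
      · rcases h4.eq_or_lt with rfl | h4
        · exact hb
        · exact hh _ (by omega) (by omega)
  · refine ⟨b - 2, by omega, le_rfl, Or.inr (Or.inr (Or.inl ?_))⟩
    ext z
    simp only [Finset.mem_union, Finset.mem_Icc, Finset.mem_insert, Finset.mem_singleton]
    constructor
    · intro hz
      have h3 := hmem _ hz
      have h4 : ¬ (2 ≤ z ∧ z ≤ x) := fun h5 => hl _ h5.1 h5.2 hz
      have h5 : ¬ (x ≤ z ∧ z ≤ b - 2) := fun h6 => hh _ h6.1 h6.2 hz
      omega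
    · rintro ((rfl | rfl) | ⟨h3, h4⟩)
      · exact h0
      · exact h1
      · rcases h4.eq_or_lt with rfl | h4
        · exact hb
        · rwa [show z = b - 1 by omega]

theorem IsReducedPair.isExceptional {A : Finset ℤ} {b u v : ℤ} {N : ℕ} (hb : 0 < b)
    (h0A : 0 ∈ A) (hbA : b ∈ A)
    (hmin : ∀ a ∈ A, 0 ≤ a) (hmax : ∀ a ∈ A, a ≤ b) {C L L' : List ℤ}
    (h : IsReducedPair A b u C L L') (huv : u + v = b * N)
    (hlow : (C ++ L).sum ≤ u) (hhigh : b * (C ++ L').length - (C ++ L').sum ≤ v)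
    (hfail : ∀ s : List ℤ, (∀ a ∈ s, a ∈ A) → b ∣ s.sum - u → s.sum ≤ u →
      ¬ b * s.length - s.sum ≤ v)
    (hN : (Finset.Icc 0 b \ A).card ≤ N) : IsExceptional A b := by
  obtain ⟨rfl, hxy, -⟩ := h.extremal hb hmin hmax huv hlow hhigh hfail hN
  rw [List.nil_append] at hlow hhigh
  have hT : IsMinRep A b u 0 1 L := by simpa using h.low
  have hT' : IsMinRep A b u b (-1) L' := by simpa using h.high
  have hlt := fun a => hT.pos_lt (weight_nonneg_low hmin) hmin hmax (a := a)
  have hlt' := fun a => hT'.pos_lt (weight_nonneg_high hmax) hmin hmax (a := a)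
  have hdvd := dvd_sub hT.2.1 hT'.2.1
  rw [sub_sub_sub_cancel_right] at hdvd
  have hne : L ≠ [] := by
    rintro rfl
    have : L' = [] := IsMinRep.eq_nil_of_dvd (P := []) (R := []) (weight_nonneg_high hmax)
      (by simpa using hT') (by simpa using hdvd)
    subst this
    simp at hxy
    omega
  have hne' : L' ≠ [] := by
    rintro rfl
    exact hne (IsMinRep.eq_nil_of_dvd (P := []) (R := []) (weight_nonneg_low hmin)
      (by simpa using hT) (by simpa using hdvd))
  have hx0 := ((L.sum_nonneg_and_pos hlt).2.2 hne).1
  have hy0 := ((L'.sum_nonneg_and_pos hlt').2.2 hne').2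
  have hxA : L.sum ∉ A := fun hx =>
    hfail [L.sum] (by simpa using hx) (by simpa using hT.2.1) (by simpa using hlow)
      (by simp; linarith)
  have hcover : ∀ K K' : List ℤ, K.Perm L → K'.Perm L' → ∀ z, 0 < z → z < b → z ∉ A →
      (∃ i, (K.take i).sum = z) ∨
        ∃ j, b * (K'.take j).length - (K'.take j).sum = b - z := by
    intro K K' hK hK' z hz hzb hzA
    refine (h.perm hK hK').exists_take_sum_eq hb hmin hmax huv ?_ ?_ hfail hN ?_ ?_ hz hzb hzA
    · rwa [hK.sum_eq]
    · rwa [hK'.sum_eq, hK'.length_eq]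
    · rw [hK.sum_eq]; linarith
    · rw [hK'.sum_eq, hK'.length_eq]; linarith
  have hleft := missing_dichotomy (b := b) hT.1 (fun a ha => (hlt a ha).1) hx0 (by linarith) hxA
    (fun s hs e => (hT.2.2 s hs (by rw [e]; exact hT.2.1)).2 (by rw [e]; ring)) (by
      intro K hK z hz hzb hzA hzx
      rcases hcover K L' hK (List.Perm.refl _) z hz hzb hzA with hc | ⟨j, hj⟩
      · exact hc
      · have := (List.sum_take_bounds hlt' j).2.2.2
        exact ⟨K.length, by rw [List.take_length, hK.sum_eq]; linarith⟩)
  have hsum' := L'.sum_map_const_sub b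
  have hbx : b - (L'.map fun x => b - x).sum = L.sum := by rw [hsum']; linarith
  have hright := missing_dichotomy (A := A.image fun x => b - x) (b := b)
    (L := L'.map fun x => b - x)
    (fun a ha => by
      obtain ⟨c, hc, rfl⟩ := List.mem_map.1 ha
      exact Finset.mem_image_of_mem _ (hT'.1 c hc))
    (fun a ha => by
      obtain ⟨c, hc, rfl⟩ := List.mem_map.1 ha
      linarith [hlt' c hc, (hlt' c hc).2])
    (by rw [hsum']; exact hy0) (by rw [hsum']; linarith)
    (by rw [mem_image_const_sub, hbx]; exact hxA)
    (fun s hs e => by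
      have e2 := s.sum_map_const_sub b
      rw [List.length_map]
      have hsm : ∀ a ∈ s.map fun x => b - x, a ∈ A := fun a ha => by
        obtain ⟨c, hc, rfl⟩ := List.mem_map.1 ha
        exact mem_image_const_sub.1 (hs c hc)
      have h1 := (hT'.2.2 _ hsm (by
        obtain ⟨c, hc⟩ := hT'.2.1
        rw [e2, e, hsum']
        exact ⟨s.length - L'.length + c, by linear_combination hc⟩)).2 (by
        rw [e2, e, hsum', List.length_map]; ring)
      simpa using h1)
    (by
      intro K hK z hz hzb hzA hzx
      have hK' : (K.map fun x => b - x).Perm L' := by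
        have := hK.map (fun x => b - x)
        simpa [List.map_map, Function.comp_def] using this
      rw [mem_image_const_sub] at hzA
      rcases hcover L _ (List.Perm.refl _) hK' (b - z) (by omega) (by omega) hzA with
        ⟨i, hi⟩ | ⟨j, hj⟩
      · have := (List.sum_take_bounds hlt i).2.1
        exact ⟨K.length, by rw [List.take_length, hK.sum_eq]; linarith⟩
      · refine ⟨j, ?_⟩
        rw [← List.sum_map_const_sub, ← List.map_take, List.map_map] at hj
        simpa [Function.comp_def] using hj)
  refine isExceptional_of_missing h0A hbA hmin hmax hleft.1 (by linarith [hright.1]) hxA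
    hleft.2 ?_
  rcases hright.2 with hr | ⟨h1, hr⟩
  · refine Or.inl fun z hz hzb => ?_
    have := mem_image_const_sub.1 (hr (b - z) (by omega) (by omega))
    simpa using this
  · refine Or.inr ⟨mem_image_const_sub.1 h1, fun z hz hzb hzA => ?_⟩
    exact hr (b - z) (by omega) (by omega) (mem_image_const_sub.2 (by simpa using hzA))

theorem exists_list_card_eq_of_le {A : Finset ℤ} {b u v : ℤ} {N : ℕ} (hb : 0 < b)
    (h0A : 0 ∈ A) (hbA : b ∈ A) (huv : u + v = b * N) {s : List ℤ} (hs : ∀ a ∈ s, a ∈ A)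
    (hd : b ∣ s.sum - u) (hlow : s.sum ≤ u) (hhigh : b * s.length - s.sum ≤ v) :
    ∃ t : List ℤ, t.length = N ∧ (∀ a ∈ t, a ∈ A) ∧ t.sum = u := by
  obtain ⟨c, hc⟩ := hd
  have hc0 : c ≤ 0 := by
    by_contra! hpos
    linarith [mul_pos hb hpos]
  have hr : s.length - c ≤ N := by
    refine le_of_mul_le_mul_left (a := b) ?_ hb
    rw [mul_sub]
    linarith
  refine ⟨s ++ List.replicate (-c).toNat b ++
    List.replicate (N - (s.length + (-c).toNat)) 0, ?_, ?_, ?_⟩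
  · simp only [List.length_append, List.length_replicate]
    omega
  · intro a ha
    simp only [List.mem_append, List.mem_replicate] at ha
    rcases ha with (ha | ⟨-, rfl⟩) | ⟨-, rfl⟩
    · exact hs a ha
    · exact hbA
    · exact h0A
  · simp only [List.sum_append, List.sum_replicate, nsmul_eq_mul, mul_zero, add_zero]
    rw [Int.toNat_of_nonneg (by omega)]
    linarith

theorem mem_nfold_of_not_isExceptional {A : Finset ℤ} {b u v : ℤ} {N : ℕ} (hb : 0 < b)
    (h0A : 0 ∈ A) (hbA : b ∈ A) (hmin : ∀ a ∈ A, 0 ≤ a) (hmax : ∀ a ∈ A, a ≤ b)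
    (hexc : ¬ IsExceptional A b) (hN : (Finset.Icc 0 b \ A).card ≤ N) (huv : u + v = b * N)
    {s s' : List ℤ} (hs : ∀ a ∈ s, a ∈ A) (hsu : s.sum = u)
    (hs' : ∀ a ∈ s', a ∈ A) (hsv : b * s'.length - s'.sum = v) : u ∈ nfold A N := by
  have hdu : b ∣ s.sum - u := by simp [hsu]
  have hdv : b ∣ s'.sum - u := ⟨s'.length - N, by linear_combination -hsv - huv⟩
  obtain ⟨T, hT⟩ := exists_isMinRep (weight_nonneg_low hmin) s hs hdu
  obtain ⟨T', hT'⟩ := exists_isMinRep (weight_nonneg_high hmax) s' hs' hdv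
  obtain ⟨C, L, L', h⟩ := exists_isReducedPair hT hT'
  by_contra hnot
  refine hexc (h.isExceptional hb h0A hbA hmin hmax huv ?_ ?_ ?_ hN)
  · have := (h.low.2.2 s hs hdu).1
    linarith
  · have := (h.high.2.2 s' hs' hdv).1
    linarith
  · intro t ht hd hlow hhigh
    exact hnot ((mem_nfold_iff_exists_list A N u).2
      (exists_list_card_eq_of_le hb h0A hbA huv ht hd hlow hhigh))

theorem mem_nfold_image_const_sub {A : Finset ℤ} {b n : ℤ} {N : ℕ} :
    n ∈ nfold (A.image fun x => b - x) N ↔ b * N - n ∈ nfold A N := by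
  have key : ∀ (A : Finset ℤ) (n : ℤ), n ∈ nfold A N →
      b * N - n ∈ nfold (A.image fun x => b - x) N := by
    intro A n hn
    obtain ⟨s, rfl, hs, rfl⟩ := (mem_nfold_iff_exists_list A N n).1 hn
    refine (mem_nfold_iff_exists_list _ _ _).2 ⟨s.map fun x => b - x, by simp, fun a ha => ?_,
      s.sum_map_const_sub b⟩
    obtain ⟨c, hc, rfl⟩ := List.mem_map.1 ha
    exact Finset.mem_image_of_mem _ (hs c hc)
  constructor
  · intro h
    have := key _ _ h
    rw [Finset.image_image] at this
    simpa [Function.comp_def] using this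
  · intro h
    simpa using key _ _ h

theorem exists_list_of_notMem_postE {A : Finset ℤ} {n : ℤ} (hn : 0 ≤ n) (h : n ∉ postE A) :
    ∃ s : List ℤ, (∀ a ∈ s, a ∈ A) ∧ s.sum = n := by
  rcases hn.eq_or_lt with rfl | hpos
  · exact ⟨[], by simp⟩
  · have hP : n ∈ postP A := by
      by_contra hP
      exact h ⟨hpos, hP⟩
    obtain ⟨k, -, hk⟩ := hP
    obtain ⟨s, -, hs, hsum⟩ := (mem_nfold_iff_exists_list A k n).1 hk
    exact ⟨s, hs, hsum⟩

theorem stmt1 (A : Finset ℤ) (b : ℤ) (ℓ : ℕ) (hℓ : 1 ≤ ℓ)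
    (hcard : A.card = ℓ + 2)
    (h0 : 0 ∈ A) (hb : b ∈ A)
    (hmin : ∀ a ∈ A, 0 ≤ a) (hmax : ∀ a ∈ A, a ≤ b)
    (hgcd : A.gcd id = 1)
    (hexc : ¬ ∃ a : ℤ, 2 ≤ a ∧ a ≤ b - 2 ∧
      (A = Finset.Icc 0 b \ {a} ∨
       A.image (fun x => b - x) = Finset.Icc 0 b \ {a} ∨
       A = {0, 1} ∪ Finset.Icc (a + 1) b ∨
       A.image (fun x => b - x) = {0, 1} ∪ Finset.Icc (a + 1) b))
    (N : ℕ) (hN : max 1 (b - (ℓ : ℤ) - 1) ≤ (N : ℤ)) :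
    (↑(nfold A N) : Set ℤ) =
      Set.Icc 0 (b * N) \
        (postE A ∪ (fun m => b * N - m) '' postE (A.image (fun x => b - x))) := by
  have hsub : A ⊆ Finset.Icc 0 b := fun a ha => Finset.mem_Icc.2 ⟨hmin a ha, hmax a ha⟩
  have hle := Finset.card_le_card hsub
  rw [Int.card_Icc] at hle
  have hbpos : 0 < b := by omega
  have hmissing : (Finset.Icc 0 b \ A).card ≤ N := by
    rw [Finset.card_sdiff_of_subset hsub, Int.card_Icc]
    omega
  have hN1 : 1 ≤ N := by omega
  ext n
  simp only [Finset.mem_coe, Set.mem_sdiff, Set.mem_Icc, Set.mem_union, Set.mem_image, not_or,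
    not_exists, not_and]
  constructor
  · intro hn
    obtain ⟨s, hlen, hs, hsum⟩ := (mem_nfold_iff_exists_list A N n).1 hn
    refine ⟨⟨?_, ?_⟩, fun h => h.2 ⟨N, hN1, hn⟩, ?_⟩
    · rw [← hsum]
      exact List.sum_nonneg fun a ha => hmin a (hs a ha)
    · have := weight_nonneg (weight_nonneg_high hmax) s hs
      rw [hlen, hsum] at this
      linarith
    · rintro m ⟨-, hm⟩ rfl
      exact hm ⟨N, hN1, mem_nfold_image_const_sub.2 hn⟩
  · rintro ⟨⟨hn0, hnb⟩, hnE, hnE'⟩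
    obtain ⟨s, hs, hsum⟩ := exists_list_of_notMem_postE hn0 hnE
    obtain ⟨t, ht, htsum⟩ := exists_list_of_notMem_postE
      (A := A.image fun x => b - x) (n := b * N - n) (by linarith)
      (fun h => hnE' _ h (by ring))
    refine mem_nfold_of_not_isExceptional hbpos h0 hb hmin hmax hexc hmissing
      (v := b * N - n) (by ring) hs hsum (s' := t.map fun x => b - x) (fun a ha => ?_) ?_
    · obtain ⟨c, hc, rfl⟩ := List.mem_map.1 ha
      exact mem_image_const_sub.1 (ht c hc)
    · rw [t.sum_map_const_sub, List.length_map, htsum]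
      ring
end

section
/- Let A be a finite set of integers with minimum element 0, maximum element b, and gcd of its elements equal to 1, let ℓ := |A| − 2 satisfy ℓ ≥ 2, and let B be the image of A in ℤ/bℤ. Let N = b − ℓ − Δ for some integer Δ ≥ 0. Let K be the smallest integer such that K ≥ 2 and |KB| ≥ min(b, 2K + ℓ + Δ − 1), and assume N ≥ N_A* + K − 2. Then every integer n with 1 ≤ n ≤ bN/2 and n ∉ E(A) satisfies n ∈ NA. -/
open Pointwise

theorem add_mem_nfold_s6 {α : Type*} [AddCommMonoid α] [DecidableEq α] {A : Finset α} {m n : ℕ}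
    {x y : α} (hx : x ∈ nfold A m) (hy : y ∈ nfold A n) : x + y ∈ nfold A (m + n) := by
  induction n generalizing y with
  | zero =>
    rw [nfold, Finset.mem_singleton] at hy
    simpa [hy] using hx
  | succ n ih =>
    rw [nfold, Finset.mem_add] at hy
    obtain ⟨u, hu, v, hv, rfl⟩ := hy
    rw [← add_assoc, ← add_assoc, nfold]
    exact Finset.add_mem_add (ih hu) hv

theorem nfold_mono {α : Type*} [AddCommMonoid α] [DecidableEq α] {A : Finset α} (h0 : 0 ∈ A)
    {m n : ℕ} (h : m ≤ n) : nfold A m ⊆ nfold A n := by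
  induction n, h using Nat.le_induction with
  | base => exact Finset.Subset.refl _
  | succ n _ ih =>
    intro x hx
    rw [nfold]
    simpa using Finset.add_mem_add (ih hx) h0

theorem nsmul_mem_nfold {α : Type*} [AddCommMonoid α] [DecidableEq α] {A : Finset α} {a : α}
    (ha : a ∈ A) (n : ℕ) : n • a ∈ nfold A n := by
  induction n with
  | zero => simp [nfold]
  | succ n ih =>
    rw [succ_nsmul, nfold]
    exact Finset.add_mem_add ih ha

theorem nonneg_of_mem_nfold_s6 {A : Finset ℤ} (hmin : ∀ x ∈ A, 0 ≤ x) {n : ℕ} {x : ℤ}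
    (hx : x ∈ nfold A n) : 0 ≤ x := by
  induction n generalizing x with
  | zero =>
    rw [nfold, Finset.mem_singleton] at hx
    exact hx.ge
  | succ n ih =>
    rw [nfold, Finset.mem_add] at hx
    obtain ⟨u, hu, v, hv, rfl⟩ := hx
    exact add_nonneg (ih hu) (hmin v hv)

/-- An element of an `L`-fold sumset has a sequence of partial sums. -/
theorem exists_partial_sums_of_mem_nfold {α : Type*} [AddCommGroup α] [DecidableEq α]
    {A : Finset α} {L : ℕ} {x : α} (hx : x ∈ nfold A L) :
    ∃ s : ℕ → α, s 0 = 0 ∧ s L = x ∧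
      ∀ i j, i ≤ j → j ≤ L → s j - s i ∈ nfold A (j - i) := by
  induction L generalizing x with
  | zero =>
    rw [nfold, Finset.mem_singleton] at hx
    refine ⟨fun _ => 0, rfl, hx.symm, fun i j hij hj => ?_⟩
    have : j - i = 0 := by omega
    simp [this, nfold]
  | succ L ih =>
    rw [nfold, Finset.mem_add] at hx
    obtain ⟨u, hu, v, hv, rfl⟩ := hx
    obtain ⟨s, hs0, hsL, hs⟩ := ih hu
    refine ⟨fun i => if i ≤ L then s i else u + v, by simp [hs0], by simp, fun i j hij hj => ?_⟩
    by_cases hjL : j ≤ L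
    · have hiL : i ≤ L := hij.trans hjL
      simpa [hjL, hiL] using hs i j hij hjL
    · obtain rfl : j = L + 1 := by omega
      by_cases hiL : i ≤ L
      · have key := Finset.add_mem_add (hs i L hiL le_rfl) hv
        rw [hsL] at key
        rw [Nat.succ_sub hiL, nfold]
        simp only [hiL, if_true, hjL, if_false]
        rwa [add_sub_right_comm]
      · obtain rfl : i = L + 1 := by omega
        simp [nfold]

/-- Every element of the `m`-fold sumset of the reduction of `A` modulo `b` lifts to an element of
the `m`-fold sumset of `A` that does not use the summand `b`. -/
theorem exists_lift_of_mem_nfold_image {b : ℕ} {A : Finset ℤ} (h0 : 0 ∈ A) (hb1 : 1 ≤ b)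
    (hmax : ∀ x ∈ A, x ≤ (b : ℤ)) {m : ℕ} {z : ZMod b}
    (hz : z ∈ nfold (A.image (fun x : ℤ => (x : ZMod b))) m) :
    ∃ y ∈ nfold A m, y ≤ m * ((b : ℤ) - 1) ∧ (y : ZMod b) = z := by
  induction m generalizing z with
  | zero =>
    rw [nfold, Finset.mem_singleton] at hz
    exact ⟨0, by simp [nfold], by simp, by simp [hz]⟩
  | succ m ih =>
    rw [nfold, Finset.mem_add] at hz
    obtain ⟨u, hu, v, hv, rfl⟩ := hz
    obtain ⟨y, hy, hyb, rfl⟩ := ih hu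
    obtain ⟨x, hx, rfl⟩ := Finset.mem_image.1 hv
    obtain ⟨x', hx', hxb, hxx⟩ : ∃ x' ∈ A, x' ≤ (b : ℤ) - 1 ∧ (x' : ZMod b) = x := by
      rcases (hmax x hx).eq_or_lt with h | h
      · exact ⟨0, h0, by omega, by simp [h]⟩
      · exact ⟨x, hx, by omega, rfl⟩
    refine ⟨y + x', by rw [nfold]; exact Finset.add_mem_add hy hx', ?_, by push_cast; rw [hxx]⟩
    push_cast
    linarith

/-- A nonempty set of residues closed under translation by a set of integers with gcd `1`
is everything. -/
theorem eq_univ_of_add_mem {b : ℕ} [NeZero b] {A : Finset ℤ} (hgcd : A.gcd id = 1)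
    {Y : Finset (ZMod b)} (hY : Y.Nonempty)
    (h : ∀ y ∈ Y, ∀ x ∈ A, y + (x : ZMod b) ∈ Y) : Y = Finset.univ := by
  let S : AddSubgroup ℤ := (AddAction.stabilizer (ZMod b) Y).comap (Int.castAddHom (ZMod b))
  have hS : ∀ k : ℤ, k ∈ S ↔ (k : ZMod b) +ᵥ Y = Y := fun k => Iff.rfl
  have hAS : ∀ x ∈ A, x ∈ S := by
    intro x hx
    rw [hS]
    refine Finset.eq_of_subset_of_card_le ?_ (by simp)
    intro z hz
    obtain ⟨y, hy, rfl⟩ := Finset.mem_vadd_finset.1 hz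
    rw [vadd_eq_add, add_comm]
    exact h y hy x hx
  obtain ⟨g, hg⟩ := Int.subgroup_cyclic S
  have hdvd : g ∣ 1 := by
    rw [← hgcd]
    refine Finset.dvd_gcd fun x hx => ?_
    have := hAS x hx
    rw [hg, AddSubgroup.mem_closure_singleton] at this
    obtain ⟨n, hn⟩ := this
    exact ⟨n, by simp only [id, ← hn, smul_eq_mul, mul_comm]⟩
  have hall : ∀ k : ℤ, k ∈ S := by
    intro k
    rw [hg, AddSubgroup.mem_closure_singleton]
    obtain ⟨c, hc⟩ := hdvd.trans (one_dvd k)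
    exact ⟨c, by rw [hc, smul_eq_mul, mul_comm]⟩
  obtain ⟨y, hy⟩ := hY
  refine Finset.eq_univ_of_forall fun z => ?_
  obtain ⟨k, hk⟩ := ZMod.intCast_surjective (z - y)
  have h1 := (hS k).1 (hall k)
  rw [← h1]
  exact Finset.mem_vadd_finset.2 ⟨y, hy, by rw [vadd_eq_add, hk, sub_add_cancel]⟩

/-- If `X` gains exactly one element on adding `B`, where `0 ∈ B` and `B` has at least three
elements, then `X + B` is invariant under translation by `B`. -/
theorem add_mem_add_of_card_add_eq {G : Type*} [AddCommGroup G] [DecidableEq G]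
    {X B : Finset G} (h0 : 0 ∈ B) (hB : 3 ≤ B.card) (hcard : (X + B).card = X.card + 1) :
    ∀ y ∈ X + B, ∀ d ∈ B, y + d ∈ X + B := by
  have hsub : X ⊆ X + B := Finset.subset_add_left X h0
  obtain ⟨z, hz⟩ : ∃ z, (X + B) \ X = {z} := by
    rw [← Finset.card_eq_one, Finset.card_sdiff_of_subset hsub, hcard]
    omega
  have hzY : z ∈ X + B ∧ z ∉ X := by
    rw [← Finset.mem_sdiff, hz]
    exact Finset.mem_singleton_self z
  have hor : ∀ y ∈ X + B, y ∈ X ∨ y = z := by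
    intro y hy
    by_cases hyX : y ∈ X
    · exact Or.inl hyX
    · right
      rw [← Finset.mem_singleton, ← hz]
      exact Finset.mem_sdiff.2 ⟨hy, hyX⟩
  have hreach : ∀ c ∈ B, c ≠ 0 → ∃ x ∈ X, x + c = z := by
    intro c hc hc0
    by_contra! hno
    have himg : X.image (· + c) = X := by
      refine Finset.eq_of_subset_of_card_le ?_
        (Finset.card_image_of_injective X (add_left_injective c)).ge
      intro w hw
      obtain ⟨x, hx, rfl⟩ := Finset.mem_image.1 hw
      exact (hor _ (Finset.add_mem_add hx hc)).resolve_right (hno x hx)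
    obtain ⟨x, hx, e, he, hxe⟩ := Finset.mem_add.1 hzY.1
    have hxc : x + c ∈ X := by
      rw [← himg]
      exact Finset.mem_image_of_mem _ hx
    have hzc : z + c ∈ X + B := by
      rw [← hxe, add_right_comm]
      exact Finset.add_mem_add hxc he
    rcases hor _ hzc with h | h
    · rw [← himg] at h
      obtain ⟨w, hw, hwz⟩ := Finset.mem_image.1 h
      exact hzY.2 (add_right_cancel hwz ▸ hw)
    · exact hc0 (by simpa using h)
  intro y hy d hd
  rcases hor y hy with h | rfl
  · exact Finset.add_mem_add h hd
  · by_cases hd0 : d = 0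
    · simpa [hd0] using hy
    · obtain ⟨c, hc, hcn⟩ : ∃ c ∈ B, c ∉ ({0, d} : Finset G) := by
        refine Finset.exists_mem_notMem_of_card_lt_card ?_
        have := Finset.card_le_two (a := (0 : G)) (b := d)
        omega
      simp only [Finset.mem_insert, Finset.mem_singleton, not_or] at hcn
      obtain ⟨x, hx, hxc⟩ := hreach c hc hcn.1
      have hxd : x + d ∈ X := by
        refine (hor _ (Finset.add_mem_add hx hd)).resolve_right fun h => hcn.2 ?_
        exact add_left_cancel (hxc.trans h.symm)
      have := Finset.add_mem_add hxd hc
      rwa [add_right_comm, hxc] at this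

/-- Adding a generating set of at least three residues, one of which is `0`, gains at least two
elements or reaches every residue. -/
theorem min_le_card_add_image {b : ℕ} [NeZero b] {A : Finset ℤ} (h0 : 0 ∈ A)
    (hgcd : A.gcd id = 1) (hB : 3 ≤ (A.image (fun x : ℤ => (x : ZMod b))).card)
    {X : Finset (ZMod b)} (hX : X.Nonempty) :
    min b (X.card + 2) ≤ (X + A.image (fun x : ℤ => (x : ZMod b))).card := by
  set B := A.image (fun x : ℤ => (x : ZMod b)) with hBdef
  have h0B : (0 : ZMod b) ∈ B := Finset.mem_image.2 ⟨0, h0, by simp⟩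
  have hsub : X ⊆ X + B := Finset.subset_add_left X h0B
  by_contra! hlt
  rw [lt_min_iff] at hlt
  have hle := Finset.card_le_card hsub
  have hclosed : ∀ y ∈ X + B, ∀ d ∈ B, y + d ∈ X + B := by
    rcases hle.eq_or_lt with heq | hgt
    · have hXB := Finset.eq_of_subset_of_card_le hsub heq.ge
      intro y hy d hd
      rw [← hXB] at hy
      exact Finset.add_mem_add hy hd
    · exact add_mem_add_of_card_add_eq h0B hB (by omega)
  have huniv := eq_univ_of_add_mem hgcd (hX.mono hsub)
    fun y hy x hx => hclosed y hy _ (Finset.mem_image_of_mem _ hx)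
  rw [huniv, Finset.card_univ, ZMod.card] at hlt
  exact lt_irrefl _ hlt.1

theorem min_le_card_nfold_image {b : ℕ} [NeZero b] {A : Finset ℤ} (h0 : 0 ∈ A)
    (hgcd : A.gcd id = 1) (hB : 3 ≤ (A.image (fun x : ℤ => (x : ZMod b))).card)
    {c K m : ℕ} (hKm : K ≤ m)
    (hK : min b (2 * K + c) ≤ (nfold (A.image (fun x : ℤ => (x : ZMod b))) K).card) :
    min b (2 * m + c) ≤ (nfold (A.image (fun x : ℤ => (x : ZMod b))) m).card := by
  induction m, hKm using Nat.le_induction with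
  | base => exact hK
  | succ m _ ih =>
    have hne : (nfold (A.image (fun x : ℤ => (x : ZMod b))) m).Nonempty :=
      ⟨_, nsmul_mem_nfold (Finset.mem_image_of_mem _ h0) m⟩
    have := min_le_card_add_image h0 hgcd hB hne
    rw [nfold]
    omega

theorem card_image_intCast_zmod {b : ℕ} {A : Finset ℤ}
    (hmin : ∀ x ∈ A, 0 ≤ x) (hmax : ∀ x ∈ A, x ≤ (b : ℤ)) :
    A.card ≤ (A.image (fun x : ℤ => (x : ZMod b))).card + 1 := by
  have hinj : Set.InjOn (fun x : ℤ => (x : ZMod b)) (A.erase (b : ℤ)) := by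
    intro x hx y hy hxy
    simp only [Finset.coe_erase, Set.mem_sdiff, Finset.mem_coe, Set.mem_singleton_iff] at hx hy
    have hx1 := hmin x hx.1
    have hx2 := lt_of_le_of_ne (hmax x hx.1) hx.2
    have hy1 := hmin y hy.1
    have hy2 := lt_of_le_of_ne (hmax y hy.1) hy.2
    have := (ZMod.intCast_eq_intCast_iff' x y b).1 hxy
    rwa [Int.emod_eq_of_lt hx1 hx2, Int.emod_eq_of_lt hy1 hy2] at this
  have h1 := Finset.card_image_of_injOn hinj
  have h2 := Finset.card_le_card
    (Finset.image_subset_image (f := fun x : ℤ => (x : ZMod b)) (Finset.erase_subset (b : ℤ) A))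
  have h3 := Finset.pred_card_le_card_erase (s := A) (a := (b : ℤ))
  omega

theorem nmin_le {A : Finset ℤ} {b a n : ℤ} (hn : 1 ≤ n) (hP : n ∈ postP A)
    (h : n % b = a % b) : nmin A b a ≤ n :=
  csInf_le ⟨1, fun _ hx => hx.1⟩ ⟨hn, hP, h⟩

theorem nmin_spec {A : Finset ℤ} {b a n : ℤ} (hn : 1 ≤ n) (hP : n ∈ postP A)
    (h : n % b = a % b) :
    1 ≤ nmin A b a ∧ nmin A b a ∈ postP A ∧ nmin A b a % b = a % b :=
  Int.csInf_mem (s := {n : ℤ | 1 ≤ n ∧ n ∈ postP A ∧ n % b = a % b}) ⟨n, hn, hP, h⟩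
    ⟨1, fun _ hx => hx.1⟩

theorem Nmin_le {A : Finset ℤ} {b a : ℤ} {M : ℕ} (hM : 1 ≤ M) (h : nmin A b a ∈ nfold A M) :
    Nmin A b a ≤ M :=
  Nat.sInf_le ⟨hM, h⟩

theorem Nmin_spec {A : Finset ℤ} {b a : ℤ} (h : nmin A b a ∈ postP A) :
    1 ≤ Nmin A b a ∧ nmin A b a ∈ nfold A (Nmin A b a) :=
  Nat.sInf_mem (s := {N : ℕ | 1 ≤ N ∧ nmin A b a ∈ nfold A N}) h

/-- The partial sums of a shortest representation of `nmin A b a` are distinct modulo `b`. -/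
theorem injOn_partial_sums_nmin {b : ℕ} {A : Finset ℤ} {a : ℤ} (hmin : ∀ x ∈ A, 0 ≤ x)
    (ha : ¬ (b : ℤ) ∣ nmin A b a) (hmod : nmin A b a % b = a % b) {s : ℕ → ℤ} (hs0 : s 0 = 0)
    (hsL : s (Nmin A b a) = nmin A b a)
    (hs : ∀ i j, i ≤ j → j ≤ Nmin A b a → s j - s i ∈ nfold A (j - i)) {i j : ℕ} (hij : i < j)
    (hj : j ≤ Nmin A b a) : (s i : ZMod b) ≠ s j := by
  intro heq
  have hdvd : (b : ℤ) ∣ s j - s i := (ZMod.intCast_eq_intCast_iff_dvd_sub _ _ b).1 heq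
  have hd0 : 0 ≤ s j - s i := nonneg_of_mem_nfold_s6 hmin (hs i j hij.le hj)
  have hmem : nmin A b a - (s j - s i) ∈ nfold A (i + (Nmin A b a - j)) := by
    have h1 := hs 0 i (Nat.zero_le i) (hij.le.trans hj)
    have h2 := hs j _ hj le_rfl
    rw [hs0, sub_zero, Nat.sub_zero] at h1
    rw [hsL] at h2
    convert add_mem_nfold_s6 h1 h2 using 1
    ring
  have hnz : ¬ (b : ℤ) ∣ nmin A b a - (s j - s i) := fun h => ha ((dvd_sub_left hdvd).1 h)
  have hpos : 1 ≤ nmin A b a - (s j - s i) := by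
    rcases (nonneg_of_mem_nfold_s6 hmin hmem).eq_or_lt with h | h
    · exact absurd (h ▸ dvd_zero _) hnz
    · exact h
  have hlen : 1 ≤ i + (Nmin A b a - j) := by
    by_contra! h
    have h0 : i + (Nmin A b a - j) = 0 := by omega
    rw [h0, nfold, Finset.mem_singleton] at hmem
    omega
  have hle := nmin_le hpos ⟨_, hlen, hmem⟩
    (show (nmin A b a - (s j - s i)) % b = a % b by
      rw [← hmod]
      refine Int.emod_eq_emod_iff_emod_sub_eq_zero.2 (Int.emod_eq_zero_of_dvd ?_)
      rwa [sub_sub_cancel_left, dvd_neg])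
  have hz : s j - s i = 0 := by omega
  rw [hz, sub_zero] at hmem
  have := Nmin_le hlen hmem
  omega

theorem stmt6 (b : ℕ) (A : Finset ℤ)
    (h0 : 0 ∈ A) (hb : (b : ℤ) ∈ A)
    (hmin : ∀ x ∈ A, 0 ≤ x) (hmax : ∀ x ∈ A, x ≤ (b : ℤ))
    (hgcd : A.gcd id = 1)
    (ℓ : ℕ) (hcard : A.card = ℓ + 2) (hℓ : 2 ≤ ℓ)
    (Δ N K : ℕ)
    (hNdef : (N : ℤ) = (b : ℤ) - (ℓ : ℤ) - (Δ : ℤ))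
    (hK2 : 2 ≤ K)
    (hKbound : min b (2 * K + ℓ + Δ - 1) ≤
      (nfold (A.image (fun x : ℤ => (x : ZMod b))) K).card)
    (hKmin : ∀ K' : ℕ, 2 ≤ K' →
      min b (2 * K' + ℓ + Δ - 1) ≤
        (nfold (A.image (fun x : ℤ => (x : ZMod b))) K').card → K ≤ K')
    (hN : Nstar A b + K - 2 ≤ N) :
    ∀ n : ℤ, 1 ≤ n → 2 * n ≤ (b : ℤ) * N → n ∉ postE A → n ∈ nfold A N := by
  have hb1 : 1 ≤ b := by
    have hsub : A ⊆ Finset.Icc 0 (b : ℤ) := fun x hx => Finset.mem_Icc.2 ⟨hmin x hx, hmax x hx⟩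
    have := Finset.card_le_card hsub
    rw [Int.card_Icc] at this
    omega
  have : NeZero b := ⟨by omega⟩
  have hbpos : (0 : ℤ) < b := by exact_mod_cast hb1
  have hB : 3 ≤ (A.image (fun x : ℤ => (x : ZMod b))).card := by
    have := card_image_intCast_zmod hmin hmax
    omega
  intro n hn1 hn2 hnE
  have hP : n ∈ postP A := by
    by_contra h
    exact hnE ⟨hn1, h⟩
  by_cases hdvd : (b : ℤ) ∣ n
  · obtain ⟨q, rfl⟩ := hdvd
    have hq0 : 0 < q := pos_of_mul_pos_right (by omega) hbpos.le
    lift q to ℕ using hq0.le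
    have hqN : (2 * q : ℤ) ≤ N := le_of_mul_le_mul_left (by linarith) hbpos
    have := nsmul_mem_nfold hb q
    rw [nsmul_eq_mul, mul_comm] at this
    exact nfold_mono h0 (by omega) this
  set a := n % b with ha
  have hamod : n % (b : ℤ) = a % b := by rw [ha, Int.emod_emod]
  have haIcc : a ∈ Finset.Icc 1 ((b : ℤ) - 1) := by
    have h1 := Int.emod_nonneg n hbpos.ne'
    have h2 := Int.emod_lt_of_pos n hbpos
    have h3 : n % (b : ℤ) ≠ 0 := fun h => hdvd (Int.dvd_of_emod_eq_zero h)
    rw [Finset.mem_Icc]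
    omega
  obtain ⟨hna1, hnaP, hnamod⟩ := nmin_spec hn1 hP hamod
  obtain ⟨hL1, hLmem⟩ := Nmin_spec hnaP
  have hLstar : Nmin A b a ≤ Nstar A b := Finset.le_sup (f := fun a => Nmin A b a) haIcc
  have hle := nmin_le hn1 hP hamod
  have hnadvd : ¬ (b : ℤ) ∣ nmin A b a := by
    intro h
    apply hdvd
    apply Int.dvd_of_emod_eq_zero
    rw [hamod, ← hnamod]
    exact Int.emod_eq_zero_of_dvd h
  obtain ⟨k, hk⟩ : (b : ℤ) ∣ n - nmin A b a :=
    Int.dvd_of_emod_eq_zero (Int.emod_eq_emod_iff_emod_sub_eq_zero.1 (hamod.trans hnamod.symm))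
  have hk0 : 0 ≤ k := nonneg_of_mul_nonneg_right (by omega) hbpos
  lift k to ℕ using hk0
  by_cases hshort : Nmin A b a + k ≤ N
  · have := add_mem_nfold_s6 hLmem (nsmul_mem_nfold hb k)
    rw [nsmul_eq_mul, mul_comm, ← hk, add_sub_cancel] at this
    exact nfold_mono h0 hshort this
  have hkN : 2 * k < N := by
    have : (2 * k : ℤ) < N := lt_of_mul_lt_mul_left (a := (b : ℤ)) (by linarith) hbpos.le
    omega
  have hKk := min_le_card_nfold_image (c := ℓ + Δ - 1) (K := K) (m := k + 1) h0 hgcd hB (by omega)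
    (by convert hKbound using 2; omega)
  obtain ⟨s, hs0, hsL, hs⟩ := exists_partial_sums_of_mem_nfold hLmem
  have hsinj : Set.InjOn (fun j : ℕ => ((nmin A b a - s j : ℤ) : ZMod b))
      (Finset.range (N - 2 * k)) := by
    intro i hi j hj hij
    simp only [Finset.coe_range, Set.mem_Iio] at hi hj
    have heq : (s i : ZMod b) = s j := by
      push_cast at hij
      exact sub_right_injective hij
    rcases lt_trichotomy i j with h | h | h
    · exact absurd heq (injOn_partial_sums_nmin hmin hnadvd hnamod hs0 hsL hs h (by omega))
    · exact h
    · exact absurd heq.symm (injOn_partial_sums_nmin hmin hnadvd hnamod hs0 hsL hs h (by omega))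
  have hcardS := Finset.card_image_of_injOn hsinj
  rw [Finset.card_range] at hcardS
  obtain ⟨z, hz⟩ : (((Finset.range (N - 2 * k)).image
      (fun j : ℕ => ((nmin A b a - s j : ℤ) : ZMod b))) ∩
      nfold (A.image (fun x : ℤ => (x : ZMod b))) (k + 1)).Nonempty := by
    refine Finset.inter_nonempty_of_card_lt_card_add_card (Finset.subset_univ _)
      (Finset.subset_univ _) ?_
    rw [hcardS, Finset.card_univ, ZMod.card]
    omega
  obtain ⟨hz1, hz2⟩ := Finset.mem_inter.1 hz
  obtain ⟨j, hj, rfl⟩ := Finset.mem_image.1 hz1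
  rw [Finset.mem_range] at hj
  obtain ⟨y, hy, hyb, hyz⟩ := exists_lift_of_mem_nfold_image h0 hb1 hmax hz2
  have hjL : j ≤ Nmin A b a := by omega
  have hsj := hs 0 j (Nat.zero_le j) hjL
  rw [hs0, sub_zero, Nat.sub_zero] at hsj
  have hrest := nonneg_of_mem_nfold_s6 hmin (hs j _ hjL le_rfl)
  rw [hsL] at hrest
  have hmem := add_mem_nfold_s6 hsj hy
  obtain ⟨t, ht⟩ : (b : ℤ) ∣ y - (nmin A b a - s j) :=
    (ZMod.intCast_eq_intCast_iff_dvd_sub _ _ b).1 hyz.symm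
  have hdt : (b : ℤ) ∣ s j + y - nmin A b a := ⟨t, by rw [← ht]; ring⟩
  have hnz : s j + y ≠ 0 := by
    intro h
    rw [h, zero_sub, dvd_neg] at hdt
    exact hnadvd hdt
  have hge : nmin A b a ≤ s j + y := by
    have h1 := nonneg_of_mem_nfold_s6 hmin hmem
    refine nmin_le (by omega) ⟨_, by omega, hmem⟩ ?_
    rw [← hnamod]
    exact Int.emod_eq_emod_iff_emod_sub_eq_zero.2 (Int.emod_eq_zero_of_dvd hdt)
  have ht0 : 0 ≤ t := nonneg_of_mul_nonneg_right (by omega) hbpos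
  have htk : t < k + 1 := by
    push_cast at hyb
    refine lt_of_mul_lt_mul_left (a := (b : ℤ)) ?_ hbpos.le
    nlinarith
  obtain ⟨r, hr⟩ := Int.eq_ofNat_of_zero_le (a := k - t) (by omega)
  have hfin := add_mem_nfold_s6 hmem (nsmul_mem_nfold hb r)
  have hn : s j + y + r • (b : ℤ) = n := by
    rw [nsmul_eq_mul, ← hr]
    linear_combination ht - hk
  rw [hn] at hfin
  exact nfold_mono h0 (by omega) hfin
end

section
/- Let b ≥ 2 and suppose B is a subset of ℤ/bℤ which contains 0, generates all of ℤ/bℤ as a group, and has ℓ ≥ 2 non-zero elements. Write A = B ∪ {b} viewed via representatives in {0,...,b}. Then |2B| ≥ min(b, ℓ + 4), except when A has one of the following forms: {0 < h < 2h < b} with gcd(h,b)=1; {0 < 2h−b < h < b} with gcd(h,b)=1; {0 < h < b−h < b} with gcd(h,b)=1; {0 < h, b/2 < b} with b even and gcd(h, b/2)=1; {0 < h < h + b/2 < b} with b even and gcd(h, b/2)=1; or {0 < h < b/2 < h + b/2 < b} with b even and gcd(h, b/2)=1. -/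
open Pointwise

lemma not_nodup_of_card_lt {α : Type*} [DecidableEq α] {S : Finset α} {l : List α}
    (hS : S.card < l.length) (hl : ∀ x ∈ l, x ∈ S) : ¬ l.Nodup := fun h => by
  have := Finset.card_le_card (s := l.toFinset) (t := S) (fun x hx => hl x (by simpa using hx))
  rw [List.toFinset_card_of_nodup h] at this
  omega

lemma exists_eq_of_card_lt_seven {α : Type*} [DecidableEq α] {S : Finset α} (hS : S.card ≤ 6)
    {x₁ x₂ x₃ x₄ x₅ x₆ x₇ : α} (h₁ : x₁ ∈ S) (h₂ : x₂ ∈ S) (h₃ : x₃ ∈ S) (h₄ : x₄ ∈ S)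
    (h₅ : x₅ ∈ S) (h₆ : x₆ ∈ S) (h₇ : x₇ ∈ S) :
    x₁ = x₂ ∨ x₁ = x₃ ∨ x₁ = x₄ ∨ x₁ = x₅ ∨ x₁ = x₆ ∨ x₁ = x₇ ∨ x₂ = x₃ ∨ x₂ = x₄ ∨ x₂ = x₅ ∨
    x₂ = x₆ ∨ x₂ = x₇ ∨ x₃ = x₄ ∨ x₃ = x₅ ∨ x₃ = x₆ ∨ x₃ = x₇ ∨ x₄ = x₅ ∨ x₄ = x₆ ∨ x₄ = x₇ ∨
    x₅ = x₆ ∨ x₅ = x₇ ∨ x₆ = x₇ := by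
  have := not_nodup_of_card_lt (S := S) (l := [x₁, x₂, x₃, x₄, x₅, x₆, x₇]) (by simp; omega)
    (by simp [*])
  by_contra! H
  exact this (by simp [H])

lemma mul_eq_zero_of_four_term {R : Type*} [CommRing R] [DecidableEq R] {B : Finset R}
    (hcard : (B + B).card ≤ 6) {r d : R} (h₁ : r - d ∈ B) (h₂ : r ∈ B) (h₃ : r + d ∈ B)
    (h₄ : r + 2 * d ∈ B) :
    d = 0 ∨ 2 * d = 0 ∨ 3 * d = 0 ∨ 4 * d = 0 ∨ 5 * d = 0 ∨ 6 * d = 0 := by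
  obtain h | h | h | h | h | h | h | h | h | h | h | h | h | h | h | h | h | h | h | h | h :=
    exists_eq_of_card_lt_seven hcard (Finset.add_mem_add h₄ h₄) (Finset.add_mem_add h₄ h₃)
      (Finset.add_mem_add h₄ h₂) (Finset.add_mem_add h₂ h₃) (Finset.add_mem_add h₂ h₂)
      (Finset.add_mem_add h₁ h₂) (Finset.add_mem_add h₁ h₁)
  all_goals first
    | exact .inl (by linear_combination h)
    | exact .inr (.inl (by linear_combination h))
    | exact .inr (.inr (.inl (by linear_combination h)))
    | exact .inr (.inr (.inr (.inl (by linear_combination h))))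
    | exact .inr (.inr (.inr (.inr (.inl (by linear_combination h)))))
    | exact .inr (.inr (.inr (.inr (.inr (by linear_combination h)))))

lemma eq_add_of_two_mul_eq {R : Type*} [CommRing R] [DecidableEq R] {B : Finset R}
    (hcard : (B + B).card ≤ 6) {p q r s : R} (hp : p ∈ B) (hq : q ∈ B) (hr : r ∈ B) (hs : s ∈ B)
    (hpq : p ≠ q) (hpr : p ≠ r) (hps : p ≠ s) (hqr : q ≠ r) (hqs : q ≠ s) (hrs : r ≠ s)
    (hord : ∀ n : ℕ, 0 < n → n ≤ 6 → n * (q - p) = 0 → n * (r - p) = 0 → n * (s - p) = 0 → False)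
    (h2 : p + p = q + q) : s = r + q - p := by
  by_contra hne
  have h4 := hord 4 (by norm_num) (by norm_num)
  have h6 := hord 6 (by norm_num) (by norm_num)
  push_cast at h4 h6
  have h₁ : r + s = p + p ∨ r + s = p + q := by
    obtain h | h | h | h | h | h | h | h | h | h | h | h | h | h | h | h | h | h | h | h | h :=
      exists_eq_of_card_lt_seven hcard (Finset.add_mem_add hp hp)
        (Finset.add_mem_add hp hq)
        (Finset.add_mem_add hp hr)
        (Finset.add_mem_add hq hr)
        (Finset.add_mem_add hp hs)
        (Finset.add_mem_add hq hs)
        (Finset.add_mem_add hr hs)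
    all_goals first
      | exact .inl h.symm
      | exact .inr h.symm
      | exact absurd (by linear_combination h) hpq
      | exact absurd (by linear_combination h) hpr
      | exact absurd (by linear_combination h) hps
      | exact absurd (by linear_combination h) hqr
      | exact absurd (by linear_combination h) hqs
      | exact absurd (by linear_combination h) hrs
      | exact absurd (by linear_combination -h) hpr
      | exact absurd (by linear_combination -h) hps
      | exact absurd (by linear_combination h - h2) hqr
      | exact absurd (by linear_combination h - h2) hqs
      | exact absurd (by linear_combination -h - h2) hne
      | exact absurd (by linear_combination -h) hne
      | exact absurd (by linear_combination h + h2) hne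
      | exact absurd (by linear_combination h - h2) hne
      | exact absurd (by linear_combination -h + h2) hne
  have h₂ : r + r = p + p ∨ r + r = p + q ∨ r + r = p + s ∨ r + r = q + s := by
    obtain h | h | h | h | h | h | h | h | h | h | h | h | h | h | h | h | h | h | h | h | h :=
      exists_eq_of_card_lt_seven hcard (Finset.add_mem_add hp hp)
        (Finset.add_mem_add hp hq)
        (Finset.add_mem_add hp hr)
        (Finset.add_mem_add hq hr)
        (Finset.add_mem_add hp hs)
        (Finset.add_mem_add hq hs)
        (Finset.add_mem_add hr hr)
    all_goals first
      | exact .inl h.symm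
      | exact .inr (.inl h.symm)
      | exact .inr (.inr (.inl h.symm))
      | exact .inr (.inr (.inr h.symm))
      | exact absurd (by linear_combination h) hpq
      | exact absurd (by linear_combination h) hpr
      | exact absurd (by linear_combination h) hps
      | exact absurd (by linear_combination h) hqr
      | exact absurd (by linear_combination h) hqs
      | exact absurd (by linear_combination h) hrs
      | exact absurd (by linear_combination -h) hpr
      | exact absurd (by linear_combination -h) hps
      | exact absurd (by linear_combination h - h2) hqr
      | exact absurd (by linear_combination h - h2) hqs
      | exact absurd (by linear_combination -h - h2) hne
      | exact absurd (by linear_combination -h) hne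
      | exact absurd (by linear_combination h + h2) hne
      | exact absurd (by linear_combination h - h2) hne
      | exact absurd (by linear_combination -h + h2) hne
  have hx : 2 * (r + s) = 4 * p := by
    rcases h₁ with h | h
    · linear_combination 2 * h
    · linear_combination 2 * h - h2
  have hy : 4 * r = 4 * p ∨ 4 * r = 2 * p + 2 * s := by
    rcases h₂ with h | h | h | h
    · exact .inl (by linear_combination 2 * h)
    · exact .inl (by linear_combination 2 * h - h2)
    · exact .inr (by linear_combination 2 * h)
    · exact .inr (by linear_combination 2 * h - h2)
  rcases hy with hy | hy
  · exact h4 (by linear_combination -2 * h2) (by linear_combination hy)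
      (by linear_combination 2 * hx - hy)
  · exact h6 (by linear_combination -3 * h2) (by linear_combination hx + hy)
      (by linear_combination 2 * hx - hy)

lemma add_ne_two_mul {R : Type*} [CommRing R] [DecidableEq R] {B : Finset R}
    (hcard : (B + B).card ≤ 6) {p q r s : R} (hp : p ∈ B) (hq : q ∈ B) (hr : r ∈ B) (hs : s ∈ B)
    (hpq : p ≠ q) (hpr : p ≠ r) (hps : p ≠ s) (hqr : q ≠ r) (hqs : q ≠ s) (hrs : r ≠ s)
    (hord : ∀ n : ℕ, 0 < n → n ≤ 6 → n * (p - r) = 0 → n * (q - r) = 0 → n * (s - r) = 0 → False)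
    (hinj : ∀ x ∈ B, ∀ y ∈ B, x + x = y + y → x = y) : p + q ≠ r + r := by
  intro h
  obtain ⟨d, rfl⟩ : ∃ d, p = r + d := ⟨p - r, by ring⟩
  obtain ⟨e, rfl⟩ : ∃ e, s = r + e := ⟨s - r, by ring⟩
  obtain rfl : q = r - d := by linear_combination h
  have i0 : d ≠ 0 := fun h => hpr (by linear_combination h)
  have i1 : 2 * d ≠ 0 := fun h => hpq (by linear_combination h)
  have j0 : e ≠ 0 := fun h => hrs (by linear_combination -h)
  have j1 : e ≠ d := fun h => hps (by linear_combination -h)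
  have j2 : e ≠ -d := fun h => hqs (by linear_combination -h)
  have hord' (n : ℕ) (hn : 0 < n) (hn' : n ≤ 6) (h : n * d = 0) (h' : n * e = 0) : False :=
    hord n hn hn' (by linear_combination h) (by linear_combination -h) (by linear_combination h')
  clear hord
  have h3 := hord' 3 (by norm_num) (by norm_num)
  have h5 := hord' 5 (by norm_num) (by norm_num)
  have h6 := hord' 6 (by norm_num) (by norm_num)
  push_cast at h3 h5 h6
  have m1 := Finset.add_mem_add hp hp
  have m2 := Finset.add_mem_add hp hr
  have m3 := Finset.add_mem_add hr hr
  have m4 := Finset.add_mem_add hq hr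
  have m5 := Finset.add_mem_add hq hq
  have m6 := Finset.add_mem_add hp hs
  have m7 := Finset.add_mem_add hr hs
  have m8 := Finset.add_mem_add hq hs
  have m9 := Finset.add_mem_add hs hs
  have c4 : 4 * d ≠ 0 := fun h =>
    hpq (hinj _ hp _ hq (by linear_combination h))
  have c3 : 3 * d ≠ 0 := by
    intro h3d
    obtain h | h | h | h | h | h | h | h | h | h | h | h | h | h | h | h | h | h | h | h | h :=
      exists_eq_of_card_lt_seven hcard m2 m3 m4 m6 m7 m8 m9
    all_goals first
      | exact i0 (by linear_combination h)
      | exact i1 (by linear_combination h)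
      | exact j0 (by linear_combination -h)
      | exact j1 (by linear_combination -h)
      | exact j2 (by linear_combination -h)
      | exact j1 (by linear_combination -h - h3d)
      | exact j2 (by linear_combination -h + h3d)
      | exact h6 (by linear_combination 2 * h3d) (by linear_combination -3 * h)
      | exact h6 (by linear_combination 2 * h3d) (by linear_combination -3 * h + h3d)
      | exact h6 (by linear_combination 2 * h3d) (by linear_combination -3 * h - h3d)
  have hcol : e = 2 * d ∨ e = -2 * d ∨ e = -3 * d := by
    obtain h | h | h | h | h | h | h | h | h | h | h | h | h | h | h | h | h | h | h | h | h :=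
      exists_eq_of_card_lt_seven hcard m1 m2 m3 m4 m5 m6 m7
    all_goals first
      | exact absurd (by linear_combination h) i0
      | exact absurd (by linear_combination h) i1
      | exact absurd (by linear_combination h) c3
      | exact absurd (by linear_combination h) c4
      | exact absurd (by linear_combination -h) j0
      | exact absurd (by linear_combination -h) j1
      | exact absurd (by linear_combination -h) j2
      | exact .inl (by linear_combination -h)
      | exact .inr (.inl (by linear_combination -h))
      | exact .inr (.inr (by linear_combination -h))
  have hcol' : e = 2 * d ∨ e = -2 * d ∨ e = 3 * d := by
    obtain h | h | h | h | h | h | h | h | h | h | h | h | h | h | h | h | h | h | h | h | h :=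
      exists_eq_of_card_lt_seven hcard m1 m2 m3 m4 m5 m8 m7
    all_goals first
      | exact absurd (by linear_combination h) i0
      | exact absurd (by linear_combination h) i1
      | exact absurd (by linear_combination h) c3
      | exact absurd (by linear_combination h) c4
      | exact absurd (by linear_combination -h) i0
      | exact absurd (by linear_combination -h) j0
      | exact absurd (by linear_combination -h) j1
      | exact absurd (by linear_combination -h) j2
      | exact .inl (by linear_combination -h)
      | exact .inr (.inl (by linear_combination -h))
      | exact .inr (.inr (by linear_combination -h))
  have hdbl (he : e = 2 * d ∨ e = -2 * d) : False := by
    obtain h | h | h | h | h | h :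
        d = 0 ∨ 2 * d = 0 ∨ 3 * d = 0 ∨ 4 * d = 0 ∨ 5 * d = 0 ∨ 6 * d = 0 := by
      rcases he with rfl | rfl
      · exact mul_eq_zero_of_four_term hcard hq hr hp hs
      · simpa using mul_eq_zero_of_four_term (d := -d) hcard (by simpa using hp) hr
          (by simpa [sub_eq_add_neg] using hq) (by simpa using hs)
    · exact i0 h
    · exact i1 h
    · exact c3 h
    · exact c4 h
    · refine h5 h ?_
      rcases he with he | he
      · linear_combination 5 * he + 2 * h
      · linear_combination 5 * he - 2 * h
    · refine h6 h ?_
      rcases he with he | he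
      · linear_combination 6 * he + 2 * h
      · linear_combination 6 * he - 2 * h
  rcases hcol with he | he | he
  · exact hdbl (.inl he)
  · exact hdbl (.inr he)
  · rcases hcol' with he' | he' | he'
    · exact hdbl (.inl he')
    · exact hdbl (.inr he')
    · exact h6 (by linear_combination he - he') (by linear_combination 3 * he + 3 * he')

lemma exists_two_mul_eq {R : Type*} [CommRing R] [DecidableEq R] {B : Finset R}
    (hcard : (B + B).card ≤ 6) (hB : B.card = 4)
    (hord : ∀ n : ℕ, 0 < n → n ≤ 6 → ¬ ∀ x ∈ B, ∀ y ∈ B, n * (x - y) = 0) :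
    ∃ x ∈ B, ∃ y ∈ B, x ≠ y ∧ x + x = y + y := by
  by_contra! hno
  have hinj : ∀ x ∈ B, ∀ y ∈ B, x + x = y + y → x = y := fun x hx y hy h => by
    by_contra hxy
    exact hno x hx y hy hxy h
  obtain ⟨p, hp⟩ : B.Nonempty := Finset.card_pos.1 (by omega)
  obtain ⟨q, r, s, hqr, hqs, hrs, hBp⟩ := Finset.card_eq_three.1
    (show (B.erase p).card = 3 by rw [Finset.card_erase_of_mem hp, hB])
  have hBeq : B = {p, q, r, s} := by rw [← Finset.insert_erase hp, hBp]
  obtain ⟨hqp, hq⟩ := Finset.mem_erase.1 (show q ∈ B.erase p by simp [hBp])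
  obtain ⟨hrp, hr⟩ := Finset.mem_erase.1 (show r ∈ B.erase p by simp [hBp])
  obtain ⟨hsp, hs⟩ := Finset.mem_erase.1 (show s ∈ B.erase p by simp [hBp])
  have hap {w x y z : R} (hw : w ∈ B) (hx : x ∈ B) (hy : y ∈ B) (hz : z ∈ B) (hwx : w ≠ x)
      (hwy : w ≠ y) (hwz : w ≠ z) (hxy : x ≠ y) (hxz : x ≠ z) (hyz : y ≠ z)
      (hBw : B = {w, x, y, z}) : w + x ≠ y + y := by
    refine add_ne_two_mul hcard hw hx hy hz hwx hwy hwz hxy hxz hyz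
      (fun n hn hn' h₁ h₂ h₃ => hord n hn hn' fun u hu v hv => ?_) hinj
    have key : ∀ u ∈ B, (n : R) * (u - y) = 0 := by
      rw [hBw]
      simp [h₁, h₂, h₃]
    linear_combination key u hu - key v hv
  have hperm {w x y z : R}
      (h : ∀ u, u = p ∨ u = q ∨ u = r ∨ u = s ↔ u = w ∨ u = x ∨ u = y ∨ u = z) :
      B = {w, x, y, z} := by
    ext u
    simpa [hBeq] using h u
  have a₁ := hap hp hq hr hs hqp.symm hrp.symm hsp.symm hqr hqs hrs hBeq
  have a₂ := hap hp hq hs hr hqp.symm hsp.symm hrp.symm hqs hqr hrs.symm (hperm (by tauto))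
  have a₃ := hap hp hr hq hs hrp.symm hqp.symm hsp.symm hqr.symm hrs hqs (hperm (by tauto))
  have a₄ := hap hp hr hs hq hrp.symm hsp.symm hqp.symm hrs hqr.symm hqs.symm (hperm (by tauto))
  have a₅ := hap hp hs hq hr hsp.symm hqp.symm hrp.symm hqs.symm hrs.symm hqr (hperm (by tauto))
  have a₆ := hap hp hs hr hq hsp.symm hrp.symm hqp.symm hrs.symm hqs.symm hqr.symm
    (hperm (by tauto))
  have b₁ := hno p hp q hq hqp.symm
  have b₂ := hno p hp r hr hrp.symm
  have b₃ := hno p hp s hs hsp.symm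
  have b₄ := hno q hq r hr hqr
  have b₅ := hno q hq s hs hqs
  have b₆ := hno r hr s hs hrs
  obtain h | h | h | h | h | h | h | h | h | h | h | h | h | h | h | h | h | h | h | h | h :=
    exists_eq_of_card_lt_seven hcard (Finset.add_mem_add hp hp) (Finset.add_mem_add hq hq)
      (Finset.add_mem_add hr hr) (Finset.add_mem_add hs hs) (Finset.add_mem_add hp hq)
      (Finset.add_mem_add hp hr) (Finset.add_mem_add hp hs)
  exacts [b₁ h, b₂ h, b₃ h, hqp (add_left_cancel h).symm, hrp (add_left_cancel h).symm,
    hsp (add_left_cancel h).symm, b₄ h, b₅ h, hqp (add_right_cancel h), a₃ h.symm, a₅ h.symm,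
    b₆ h, a₁ h.symm, hrp (add_right_cancel h), a₆ h.symm, a₂ h.symm, a₄ h.symm,
    hsp (add_right_cancel h), hqr (add_left_cancel h), hqs (add_left_cancel h),
    hrs (add_left_cancel h)]

lemma card_add_self_eq_of_doubling_lt_three_halves {G : Type*} [AddCommGroup G] [DecidableEq G]
    {B : Finset G} (h0 : 0 ∈ B) (hgen : AddSubgroup.closure (B : Set G) = ⊤)
    (h : 2 * (B + B).card < 3 * B.card) : (B + B).card = Nat.card G := by
  let C : Finset (Multiplicative G) := B.map Multiplicative.ofAdd.toEmbedding
  have hmem (x : Multiplicative G) : x ∈ C ↔ x.toAdd ∈ B := by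
    simp only [C, Finset.mem_map_equiv]
    rfl
  have hCC : C * C = (B + B).map Multiplicative.ofAdd.toEmbedding := by
    ext x
    simp only [Finset.mem_mul, Finset.mem_map_equiv, Finset.mem_add, C]
    constructor
    · rintro ⟨u, hu, v, hv, rfl⟩
      exact ⟨_, hu, _, hv, rfl⟩
    · rintro ⟨u, hu, v, hv, h⟩
      exact ⟨.ofAdd u, hu, .ofAdd v, hv, by rw [← ofAdd_add, h]; rfl⟩
  have hC : ((C * C).card : ℚ) < 3 / 2 * C.card := by
    rw [hCC, Finset.card_map, Finset.card_map]
    have : (2 * (B + B).card : ℚ) < 3 * B.card := mod_cast h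
    linarith
  have htop : Finset.invMulSubgroup C hC = ⊤ := by
    have : AddSubgroup.closure (B : Set G) ≤
        Subgroup.toAddSubgroup' (Finset.invMulSubgroup C hC) := by
      rw [AddSubgroup.closure_le]
      intro x hx
      change Multiplicative.ofAdd x ∈ (Finset.invMulSubgroup C hC : Set (Multiplicative G))
      rw [Finset.invMulSubgroup_eq_inv_mul]
      exact ⟨1, by simpa [hmem] using h0, .ofAdd x, by simpa [hmem] using hx, by simp⟩
    rw [hgen, top_le_iff] at this
    ext x
    simpa using this.ge (AddSubgroup.mem_top x.toAdd)
  have := Finset.card_inv_mul_of_doubling_lt_three_halves hC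
  rw [hCC, Finset.card_map] at this
  rw [← this, ← Set.ncard_coe_finset, Finset.coe_mul,
    ← Finset.invMulSubgroup_eq_inv_mul C hC, htop, Subgroup.coe_top, Set.ncard_univ]
  exact Nat.card_congr Multiplicative.toAdd

lemma ZMod.eq_one_of_dvd_val {b : ℕ} [NeZero b] {B : Finset (ZMod b)}
    (hgen : AddSubgroup.closure (B : Set (ZMod b)) = ⊤) {d : ℕ} (hd : d ∣ b)
    (hB : ∀ x ∈ B, d ∣ x.val) : d = 1 := by
  have h : AddSubgroup.closure (B : Set (ZMod b)) ≤
      (ZMod.castHom hd (ZMod d)).toAddMonoidHom.ker := by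
    rw [AddSubgroup.closure_le]
    intro x hx
    have := (ZMod.natCast_eq_zero_iff _ _).2 (hB x hx)
    simpa [AddMonoidHom.mem_ker, ZMod.natCast_val] using this
  have h1 : (1 : ZMod b) ∈ (ZMod.castHom hd (ZMod d)).toAddMonoidHom.ker := by
    apply h
    rw [hgen]
    trivial
  have h2 : ZMod.castHom hd (ZMod d) 1 = 0 := h1
  rw [map_one, ← Nat.cast_one, ZMod.natCast_eq_zero_iff] at h2
  exact Nat.dvd_one.1 h2

lemma ZMod.dvd_of_mul_eq_zero {b : ℕ} {B : Finset (ZMod b)}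
    (hgen : AddSubgroup.closure (B : Set (ZMod b)) = ⊤) {n : ℕ}
    (hn : ∀ x ∈ B, (n : ZMod b) * x = 0) : b ∣ n := by
  have h : AddSubgroup.closure (B : Set (ZMod b)) ≤
      (AddMonoidHom.mulLeft (n : ZMod b)).ker := by
    rw [AddSubgroup.closure_le]
    exact fun x hx => by simpa [AddMonoidHom.mem_ker] using hn x hx
  have h1 : (1 : ZMod b) ∈ (AddMonoidHom.mulLeft (n : ZMod b)).ker := by
    apply h
    rw [hgen]
    trivial
  simpa [AddMonoidHom.mem_ker, ZMod.natCast_eq_zero_iff] using h1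

lemma ZMod.val_add_val_cases {b : ℕ} [NeZero b] (x y : ZMod b) :
    x.val + y.val = (x + y).val ∨ x.val + y.val = (x + y).val + b := by
  rcases lt_or_ge (x.val + y.val) b with h | h
  · exact .inl (ZMod.val_add_of_lt h).symm
  · exact .inr (ZMod.val_add_val_of_le h)

lemma eq_insert_of_card_add_self_le_six {b : ℕ} (hb : 7 ≤ b) {B : Finset (ZMod b)}
    (h0 : (0 : ZMod b) ∈ B) (hgen : AddSubgroup.closure (B : Set (ZMod b)) = ⊤)
    (hB : B.card = 4) (hcard : (B + B).card ≤ 6) :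
    ∃ m h : ZMod b, m ≠ 0 ∧ m + m = 0 ∧ B = {0, m, h, h + m} := by
  have hord : ∀ n : ℕ, 0 < n → n ≤ 6 → ¬ ∀ x ∈ B, ∀ y ∈ B, (n : ZMod b) * (x - y) = 0 := by
    intro n hn hn6 h
    have := Nat.le_of_dvd hn
      (ZMod.dvd_of_mul_eq_zero hgen (n := n) fun x hx => by simpa using h x hx 0 h0)
    omega
  obtain ⟨x, hx, y, hy, hxy, h2⟩ := exists_two_mul_eq hcard hB hord
  obtain ⟨r, s, hrs, hrs'⟩ : ∃ r s, r ≠ s ∧ (B.erase x).erase y = {r, s} := by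
    rw [← Finset.card_eq_two, Finset.card_erase_of_mem (by simp [hxy.symm, hy]),
      Finset.card_erase_of_mem hx, hB]
  have hBeq : B = {x, y, r, s} := by
    rw [← Finset.insert_erase hx, ← Finset.insert_erase (Finset.mem_erase.2 ⟨hxy.symm, hy⟩), hrs']
  have hr : r ∈ (B.erase x).erase y := by simp [hrs']
  have hs : s ∈ (B.erase x).erase y := by simp [hrs']
  simp only [Finset.mem_erase] at hr hs
  obtain rfl := eq_add_of_two_mul_eq hcard hx hy hr.2.2 hs.2.2 hxy hr.2.1.symm hs.2.1.symm
    hr.1.symm hs.1.symm hrs (fun n hn hn' h₁ h₂ h₃ => hord n hn hn' (by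
      have key : ∀ z ∈ B, (n : ZMod b) * (z - x) = 0 := by
        rw [hBeq]
        simp [h₁, h₂, h₃]
      intro z hz w hw
      linear_combination key z hz - key w hw)) h2
  have hm : y - x ≠ 0 := sub_ne_zero.2 hxy.symm
  have hmm : y - x + (y - x) = 0 := by linear_combination -h2
  have h0' := h0
  simp only [hBeq, Finset.mem_insert, Finset.mem_singleton] at h0'
  rcases h0' with h | h | h | h
  · refine ⟨y - x, r, hm, hmm, ?_⟩
    rw [hBeq, ← h]
    simp
  · refine ⟨y - x, r, hm, hmm, ?_⟩
    have hx' : y - x = x := by linear_combination h - h2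
    rw [hBeq, add_sub_assoc, hx', ← h, Finset.insert_comm]
  · refine ⟨y - x, x, hm, hmm, ?_⟩
    rw [hBeq, ← h, zero_add, add_sub_cancel]
    ext u
    simp only [Finset.mem_insert, Finset.mem_singleton]
    tauto
  · refine ⟨y - x, x, hm, hmm, ?_⟩
    have hr' : r = y - x := by linear_combination -h - hmm
    rw [hBeq, ← h, hr', add_sub_cancel]
    ext u
    simp only [Finset.mem_insert, Finset.mem_singleton]
    tauto

theorem stmt8 (b : ℕ) (hb : 2 ≤ b) (B : Finset (ZMod b))
    (ℓ : ℕ) (hℓ : 2 ≤ ℓ)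
    (h0 : (0 : ZMod b) ∈ B) (hcard : (B.erase 0).card = ℓ)
    (hgen : AddSubgroup.closure (B : Set (ZMod b)) = ⊤)
    (A : Finset ℤ) (hA : A = B.image (fun x => (x.val : ℤ)) ∪ {(b : ℤ)})
    (hexc : ¬ ((∃ h : ℤ, 0 < h ∧ h < 2 * h ∧ 2 * h < (b : ℤ) ∧ Int.gcd h b = 1 ∧
        A = {0, h, 2 * h, (b : ℤ)}) ∨
      (∃ h : ℤ, 0 < 2 * h - (b : ℤ) ∧ 2 * h - (b : ℤ) < h ∧ h < (b : ℤ) ∧ Int.gcd h b = 1 ∧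
        A = {0, 2 * h - (b : ℤ), h, (b : ℤ)}) ∨
      (∃ h : ℤ, 0 < h ∧ h < (b : ℤ) - h ∧ (b : ℤ) - h < (b : ℤ) ∧ Int.gcd h b = 1 ∧
        A = {0, h, (b : ℤ) - h, (b : ℤ)}) ∨
      (∃ h m : ℤ, (b : ℤ) = 2 * m ∧ 0 < h ∧ h < (b : ℤ) ∧ h ≠ m ∧ Int.gcd h m = 1 ∧
        A = {0, h, m, (b : ℤ)}) ∨
      (∃ h m : ℤ, (b : ℤ) = 2 * m ∧ 0 < h ∧ h < h + m ∧ h + m < (b : ℤ) ∧ Int.gcd h m = 1 ∧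
        A = {0, h, h + m, (b : ℤ)}) ∨
      (∃ h m : ℤ, (b : ℤ) = 2 * m ∧ 0 < h ∧ h < m ∧ Int.gcd h m = 1 ∧
        A = {0, h, m, h + m, (b : ℤ)}))) :
    min b (ℓ + 4) ≤ (B + B).card := by
  have : NeZero b := ⟨by omega⟩
  have hBcard : B.card = ℓ + 1 := by
    rw [← hcard, Finset.card_erase_add_one h0]
  have hpos {x : ZMod b} (hx : x ≠ 0) : 0 < x.val := ZMod.val_pos.2 hx
  have hlt (x : ZMod b) : x.val < b := ZMod.val_lt x
  by_contra! hlt_min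
  have hltb : (B + B).card < b := hlt_min.trans_le (min_le_left _ _)
  have hltℓ : (B + B).card < ℓ + 4 := hlt_min.trans_le (min_le_right _ _)
  have hdouble : 3 * (ℓ + 1) ≤ 2 * (B + B).card := by
    by_contra! h
    have := card_add_self_eq_of_doubling_lt_three_halves h0 hgen (by rwa [hBcard])
    rw [Nat.card_zmod] at this
    omega
  obtain rfl | rfl : ℓ = 2 ∨ ℓ = 3 := by omega
  · have hA' {x y : ZMod b} (hB : B = {0, x, y}) : A = {0, (x.val : ℤ), (y.val : ℤ), (b : ℤ)} := by
      ext u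
      simp [hA, hB]
    have hdvd {x y : ZMod b} (hB : B = {0, x, y}) {d : ℕ} (hb : d ∣ b) (hx : d ∣ x.val)
        (hy : d ∣ y.val) : d = 1 :=
      ZMod.eq_one_of_dvd_val hgen hb (by simp [hB, hx, hy])
    have hdouble_eq_zero {x y : ZMod b} (hB : B = {0, x, y}) (hx : x ≠ 0) (hy : y ≠ 0)
        (hxy : x ≠ y) (h : x + x = 0) : False := by
      have hv := ZMod.val_add_val_cases x x
      rw [h, ZMod.val_zero] at hv
      have hx0 := hpos hx
      have hne : x.val ≠ y.val := fun h => hxy (ZMod.val_injective b h)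
      refine hexc (.inr (.inr (.inr (.inl ⟨y.val, x.val, by omega, mod_cast hpos hy,
        mod_cast hlt y, by omega, ?_, ?_⟩))))
      · rw [Int.gcd_natCast_natCast]
        exact hdvd hB ((Nat.gcd_dvd_right _ _).trans ⟨2, by omega⟩) (Nat.gcd_dvd_right _ _)
          (Nat.gcd_dvd_left _ _)
      · rw [hA' hB, Finset.insert_comm (x.val : ℤ)]
    have hdouble_eq {x y : ZMod b} (hB : B = {0, x, y}) (hx : x ≠ 0) (hy : y ≠ 0)
        (h : x + x = y) : False := by
      have hv := ZMod.val_add_val_cases x x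
      rw [h] at hv
      have hx0 := hpos hx
      have hy0 := hpos hy
      have hxb := hlt x
      have hyb := hlt y
      have hgcd : Int.gcd (x.val : ℤ) (b : ℤ) = 1 := by
        rw [Int.gcd_natCast_natCast]
        refine hdvd hB (Nat.gcd_dvd_right _ _) (Nat.gcd_dvd_left _ _) ?_
        have hdx := Nat.gcd_dvd_left x.val b
        rcases hv with hv | hv
        · exact hv ▸ dvd_add hdx hdx
        · exact (Nat.dvd_add_left (Nat.gcd_dvd_right x.val b)).1 (hv ▸ dvd_add hdx hdx)
      rcases hv with hv | hv
      · refine hexc (.inl ⟨x.val, by omega, by omega, by omega, hgcd, ?_⟩)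
        rw [hA' hB, show (y.val : ℤ) = 2 * x.val by omega]
      · refine hexc (.inr (.inl ⟨x.val, by omega, by omega, by omega, hgcd, ?_⟩))
        rw [hA' hB, show (y.val : ℤ) = 2 * x.val - b by omega, Finset.insert_comm (x.val : ℤ)]
    have hadd_eq_zero {x y : ZMod b} (hB : B = {0, x, y}) (hx : x ≠ 0) (h : x + y = 0)
        (hxy : x.val < y.val) : False := by
      have hv := ZMod.val_add_val_cases x y
      rw [h, ZMod.val_zero] at hv
      have hx0 := hpos hx
      refine hexc (.inr (.inr (.inl ⟨x.val, by omega, by omega, by omega, ?_, ?_⟩)))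
      · rw [Int.gcd_natCast_natCast]
        refine hdvd hB (Nat.gcd_dvd_right _ _) (Nat.gcd_dvd_left _ _) ?_
        exact (Nat.dvd_add_right (Nat.gcd_dvd_left x.val b)).1
          ((Nat.gcd_dvd_right x.val b).trans ⟨1, by omega⟩)
      · rw [hA' hB, show (y.val : ℤ) = b - x.val by omega]
    have hdouble_eq_double {x y : ZMod b} (hB : B = {0, x, y}) (hx : x ≠ 0)
        (h : x + x = y + y) (hxy : x.val < y.val) : False := by
      have hvx := ZMod.val_add_val_cases x x
      have hvy := ZMod.val_add_val_cases y y
      rw [h] at hvx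
      have hx0 := hpos hx
      have hyb := hlt y
      obtain ⟨m, hm⟩ : ∃ m, y.val = x.val + m := Nat.exists_eq_add_of_le hxy.le
      have hbm : b = 2 * m := by omega
      refine hexc (.inr (.inr (.inr (.inr (.inl ⟨x.val, m, by omega, by omega, by omega, by omega,
        ?_, ?_⟩)))))
      · rw [Int.gcd_natCast_natCast]
        refine hdvd hB ((Nat.gcd_dvd_right _ _).trans ⟨2, by omega⟩) (Nat.gcd_dvd_left _ _) ?_
        rw [hm]
        exact dvd_add (Nat.gcd_dvd_left _ _) (Nat.gcd_dvd_right _ _)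
      · rw [hA' hB, show (y.val : ℤ) = x.val + m by omega]
    obtain ⟨x, y, hxy, hBxy⟩ := Finset.card_eq_two.1 hcard
    have hB : B = {0, x, y} := by rw [← Finset.insert_erase h0, hBxy]
    have hB' : B = {0, y, x} := by rw [hB, Finset.pair_comm]
    obtain ⟨hx0, hx⟩ := Finset.mem_erase.1 (show x ∈ B.erase 0 by simp [hBxy])
    obtain ⟨hy0, hy⟩ := Finset.mem_erase.1 (show y ∈ B.erase 0 by simp [hBxy])
    have hne : x.val ≠ y.val := fun h => hxy (ZMod.val_injective b h)
    have hxx : x + x ≠ 0 := hdouble_eq_zero hB hx0 hy0 hxy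
    have hyy : y + y ≠ 0 := hdouble_eq_zero hB' hy0 hx0 hxy.symm
    have hxxy : x + x ≠ y := hdouble_eq hB hx0 hy0
    have hyyx : y + y ≠ x := hdouble_eq hB' hy0 hx0
    have hsum : x + y ≠ 0 := fun h => by
      rcases hne.lt_or_gt with hv | hv
      · exact hadd_eq_zero hB hx0 h hv
      · exact hadd_eq_zero hB' hy0 (by rwa [add_comm]) hv
    have hxxyy : x + x ≠ y + y := fun h => by
      rcases hne.lt_or_gt with hv | hv
      · exact hdouble_eq_double hB hx0 h hv
      · exact hdouble_eq_double hB' hy0 h.symm hv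
    refine not_nodup_of_card_lt (S := B + B) (l := [0 + 0, 0 + x, 0 + y, x + x, y + y, x + y])
      (by simpa using hltℓ) ?_ ?_
    · simp only [List.mem_cons, List.not_mem_nil, or_false]
      rintro z (rfl | rfl | rfl | rfl | rfl | rfl) <;> apply Finset.add_mem_add <;> assumption
    · simp [hx0, hy0, hxy, hxy.symm, hx0.symm, hy0.symm, hxx.symm, hyy.symm, hxxy.symm, hyyx.symm,
        hsum.symm, hxxyy]
  · have hb7 : 7 ≤ b := by omega
    obtain ⟨m, h, hm, hmm, hB⟩ :=
      eq_insert_of_card_add_self_le_six hb7 h0 hgen hBcard (by omega)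
    have hvm := ZMod.val_add_val_cases m m
    rw [hmm, ZMod.val_zero] at hvm
    have hm0 := hpos hm
    have hform {h : ZMod b} (hB : B = {0, m, h, h + m}) (hv : h.val < (h + m).val) : False := by
      have hvh := ZMod.val_add_val_cases h m
      have hhb := hlt (h + m)
      have hh : h ≠ 0 := by
        rintro rfl
        have : B.card ≤ 2 := by
          rw [hB]
          simpa using Finset.card_le_two (a := (0 : ZMod b)) (b := m)
        omega
      have hh0 := hpos hh
      refine hexc (.inr (.inr (.inr (.inr (.inr ⟨h.val, m.val, by omega, by omega, by omega,
        ?_, ?_⟩)))))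
      · rw [Int.gcd_natCast_natCast]
        have hdh := Nat.gcd_dvd_left h.val m.val
        have hdm := Nat.gcd_dvd_right h.val m.val
        refine ZMod.eq_one_of_dvd_val hgen (hdm.trans ⟨2, by omega⟩) ?_
        have hsum : h.val + m.val = (h + m).val := by omega
        simp [hB, hdh, hdm, ← hsum, dvd_add hdh hdm]
      · have hsum : ((h + m).val : ℤ) = h.val + m.val := by omega
        rw [hA, hB, Finset.insert_comm m, ← hsum]
        ext u
        simp
    rcases lt_or_ge h.val (h + m).val with hv | hv
    · exact hform hB hv
    · have hne : (h + m).val ≠ h.val := fun hv => hm (by simpa using ZMod.val_injective b hv)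
      have hh : h + m + m = h := by rw [add_assoc, hmm, add_zero]
      refine hform (h := h + m) ?_ (by rw [hh]; omega)
      rw [hh, hB, Finset.pair_comm h]
end
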